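/- Let C₁, C₂ ⊂ ℙ²(ℂ) be smooth conics intersecting transversely, C = C₁ + C₂, let T₁, T₂, T₃, T₄ be the four common bitangent lines with tangency points P_{ik} = T_i ∩ C_k, and for i < j set ℱ_{ij} = 𝒪_{ℙ²}(1)|_C ⊗ 𝒪_C(−P_{i1} − P_{i2} − P_{j1} − P_{j2}). Then each ℱ_{ij} is a nontrivial invertible sheaf of order 2 on C whose gluing data (with respect to the four nodes of C) has exactly two +'s and two −'s, and for any three distinct indices i, j, k the sheaves ℱ_{ij}, ℱ_{ik}, ℱ_{jk} are pairwise non-isomorphic; in particular ℱ_{ij} ≇ ℱ_{ik} whenever j ≠ k. -/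

import Mathlib

/-!
Basic setup: the complex projective plane, plane curves, conic-line arrangements
with simple nodes, topological double covers and gluing data.
-/

open MvPolynomial

noncomputable section

/-- The complex projective plane `ℙ²(ℂ)`. -/
abbrev P2 : Type := Projectivization ℂ (Fin 3 → ℂ)

/-- The quotient topology on `ℙ²(ℂ)` (quotient of `ℂ³ ∖ {0}`). -/
instance : TopologicalSpace P2 :=
  (inferInstance : TopologicalSpace (Quotient (projectivizationSetoid ℂ (Fin 3 → ℂ))))

/-- Evaluation of a polynomial at (the chosen representative of) a point of `ℙ²`. -/
def pev (g : MvPolynomial (Fin 3) ℂ) (x : P2) : ℂ :=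
  MvPolynomial.eval x.rep g

/-- The zero locus in `ℙ²(ℂ)` of a (homogeneous) polynomial. -/
def zeroLocus (g : MvPolynomial (Fin 3) ℂ) : Set P2 :=
  {x : P2 | pev g x = 0}

/-- A conic-line arrangement with simple nodes `C = C₁ + ⋯ + C_k` in `ℙ²(ℂ)`:
each component is (the zero locus of) a nonzero homogeneous polynomial of degree 1 (a line)
or 2, smooth (so a degree 2 component is a smooth conic), the components are pairwise
distinct, and all intersection points are ordinary double points: every singular point lies
on exactly two components, whose tangent directions there are distinct (transversal
intersection). -/
structure ConicLineArrangement (k : ℕ) where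
  f : Fin k → MvPolynomial (Fin 3) ℂ
  deg : Fin k → ℕ
  deg_one_or_two : ∀ i, deg i = 1 ∨ deg i = 2
  homog : ∀ i, (f i).IsHomogeneous (deg i)
  ne_zero : ∀ i, f i ≠ 0
  smooth : ∀ i, ∀ x : P2, pev (f i) x = 0 → ∃ m : Fin 3, pev (pderiv m (f i)) x ≠ 0
  distinct : ∀ i j, i ≠ j → zeroLocus (f i) ≠ zeroLocus (f j)
  nodes : ∀ i j, i ≠ j → ∀ x ∈ zeroLocus (f i) ∩ zeroLocus (f j),
    (∀ l, x ∈ zeroLocus (f l) → l = i ∨ l = j) ∧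
    ¬ ∃ c : ℂ, ∀ m : Fin 3, pev (pderiv m (f j)) x = c * pev (pderiv m (f i)) x

namespace ConicLineArrangement

variable {k : ℕ}

/-- The `i`-th irreducible component `C_i` of the arrangement, as a subset of `ℙ²`. -/
def curve (A : ConicLineArrangement k) (i : Fin k) : Set P2 := zeroLocus (A.f i)

/-- The support of the arrangement: the curve `C = C₁ + ⋯ + C_k` as a subset of `ℙ²`. -/
def plane (A : ConicLineArrangement k) : Set P2 := ⋃ i, A.curve i

/-- The set `Sing(C)` of singular points of the arrangement, i.e. its nodes:
the points lying on (at least) two distinct components. -/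
def sing (A : ConicLineArrangement k) : Set P2 :=
  {x : P2 | ∃ i j, i ≠ j ∧ x ∈ A.curve i ∧ x ∈ A.curve j}

end ConicLineArrangement

/-- A topological double cover: a covering map all of whose fibers have exactly
two points. -/
def IsDoubleCover {E X : Type*} [TopologicalSpace E] [TopologicalSpace X] (φ : E → X) : Prop :=
  IsCoveringMap φ ∧ ∀ x : X, Nat.card (φ ⁻¹' {x}) = 2

/-- `SplitsOver φ S x`: the subset `S` of the total space of `φ : C' → C` is mapped
homeomorphically onto the subset `x` of `C`, i.e. `φ` restricted to `S` is a topological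
embedding with image (the subtype corresponding to) `x`. -/
def SplitsOver {E X : Type*} [TopologicalSpace E] [TopologicalSpace X]
    (φ : E → X) (S : Set E) (x : Set X) : Prop :=
  Topology.IsEmbedding (fun y : S => φ (y : E)) ∧ Set.range (fun y : S => φ (y : E)) = x


section GluingData

variable {k : ℕ}

/-- A gluing data of order two on the arrangement `C`: a map `Sing(C) → {+,-}`
(`true` stands for `+`, `false` for `-`). -/
def GluingData (A : ConicLineArrangement k) : Type := {Q : P2 // Q ∈ A.sing} → Bool

open Classical in
/-- The operation on gluing data reversing all the signs at the nodes lying on the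
component `C_i`. -/
def flipAt (A : ConicLineArrangement k) (i : Fin k) (κ : GluingData A) : GluingData A :=
  fun Q => if (Q : P2) ∈ A.curve i then !(κ Q) else κ Q

/-- Two gluing data are equivalent if one is obtained from the other by a finite number of
sign-reversal operations along components. -/
def GluingEquiv (A : ConicLineArrangement k) : GluingData A → GluingData A → Prop :=
  Relation.ReflTransGen (fun κ κ' => ∃ i, κ' = flipAt A i κ)

/-- A labeling of a topological double cover `φ` of the arrangement `C`: a choice, for each
irreducible component `C_i`, of a decomposition `φ⁻¹(C_i) = C_i⁺ ∪ C_i⁻` into two disjoint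
subsets, each mapped homeomorphically onto `C_i`. -/
def IsLabeling {C' : Type} [TopologicalSpace C'] (A : ConicLineArrangement k)
    (φ : C' → {x : P2 // x ∈ A.plane}) (piece : Fin k → Bool → Set C') : Prop :=
  (∀ i, piece i true ∩ piece i false = ∅) ∧
  (∀ i, piece i true ∪ piece i false = φ ⁻¹' {x | (x : P2) ∈ A.curve i}) ∧
  (∀ i ε, SplitsOver (fun y => ((φ y : {x : P2 // x ∈ A.plane}) : P2)) (piece i ε) (A.curve i))

/-- `κ` is the gluing data of the topological double cover `φ` (with respect to some labeling
`C_i⁺`, `C_i⁻` of the halves of the preimages of the components): at a node `Q ∈ C_i ∩ C_j`,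
`κ(Q) = +` precisely when `C_i⁺` intersects `C_j⁺` over `Q`. -/
def IsGluingDataOf {C' : Type} [TopologicalSpace C'] (A : ConicLineArrangement k)
    (φ : C' → {x : P2 // x ∈ A.plane}) (κ : GluingData A) : Prop :=
  ∃ piece : Fin k → Bool → Set C', IsLabeling A φ piece ∧
    ∀ (Q : {Q : P2 // Q ∈ A.sing}) (i j : Fin k), i ≠ j →
      (Q : P2) ∈ A.curve i → (Q : P2) ∈ A.curve j →
      (κ Q = true ↔ ∃ y, y ∈ piece i true ∧ y ∈ piece j true ∧
        ((φ y : {x : P2 // x ∈ A.plane}) : P2) = (Q : P2))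

/-- A topological double cover of the arrangement `C`, bundled. -/
structure DoubleCoverOf (A : ConicLineArrangement k) where
  total : Type
  topo : TopologicalSpace total
  map : total → {x : P2 // x ∈ A.plane}
  is_cover : IsDoubleCover (X := {x : P2 // x ∈ A.plane}) map

attribute [instance] DoubleCoverOf.topo

/-- Two topological double covers of `C` are homeomorphic over `C` if there is a
homeomorphism of total spaces commuting with the covering maps. -/
def HomeoOver {A : ConicLineArrangement k} (D D' : DoubleCoverOf A) : Prop :=
  ∃ h : D.total ≃ₜ D'.total, ∀ y, D'.map (h y) = D.map y

end GluingData

/-!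
Algebraic line bundles (invertible sheaves) on a curve `C ⊆ ℙ²(ℂ)`, presented by Čech data:
a cover of `C` by complements of zero loci of homogeneous polynomials, together with
transition functions which are restrictions of rational functions on `ℙ²` (ratios of
homogeneous polynomials of the same degree), regular and nonvanishing on the overlaps.
Every invertible sheaf on a closed curve in `ℙ²` arises this way, since the distinguished
open subsets form a basis of the Zariski topology and the regular functions on such a subset
of `C` are precisely the restrictions of rational functions on `ℙ²` regular there.
-/

section Bundles

/-- Čech data for an invertible sheaf on a curve `C ⊆ ℙ²(ℂ)`: trivializing charts are the
subsets of `C` where the homogeneous polynomial `H a` does not vanish, and the transition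
function from chart `b` to chart `a` is the degree-zero rational function
`num a b / den a b`. -/
structure BundleData (C : Set P2) where
  ι : Type
  H : ι → MvPolynomial (Fin 3) ℂ
  Hdeg : ι → ℕ
  num : ι → ι → MvPolynomial (Fin 3) ℂ
  den : ι → ι → MvPolynomial (Fin 3) ℂ
  tdeg : ι → ι → ℕ

namespace BundleData

variable {C : Set P2}

/-- Validity of Čech data for an invertible sheaf: the `H a` are homogeneous and their
nonvanishing sets cover `C`; the transition functions are degree-zero rational functions,
regular and nonvanishing on the overlaps (inside `C`), and they satisfy the cocycle
condition (written multiplied out, to avoid division). -/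
def Valid (L : BundleData C) : Prop :=
  (∀ a, (L.H a).IsHomogeneous (L.Hdeg a)) ∧
  (∀ x ∈ C, ∃ a, pev (L.H a) x ≠ 0) ∧
  (∀ a b, (L.num a b).IsHomogeneous (L.tdeg a b) ∧ (L.den a b).IsHomogeneous (L.tdeg a b)) ∧
  (∀ a b, ∀ x ∈ C, pev (L.H a) x ≠ 0 → pev (L.H b) x ≠ 0 →
    pev (L.num a b) x ≠ 0 ∧ pev (L.den a b) x ≠ 0) ∧
  (∀ a b c, ∀ x ∈ C, pev (L.H a) x ≠ 0 → pev (L.H b) x ≠ 0 → pev (L.H c) x ≠ 0 →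
    pev (L.num a b) x * pev (L.num b c) x * pev (L.den a c) x
      = pev (L.num a c) x * pev (L.den a b) x * pev (L.den b c) x)

/-- The value at `x` of the transition function from chart `b` to chart `a`. -/
def gval (L : BundleData C) (a b : L.ι) (x : P2) : ℂ :=
  pev (L.num a b) x / pev (L.den a b) x

/-- Restriction of an invertible sheaf to a subcurve `S ⊆ C` (same Čech data). -/
def restrict (L : BundleData C) (S : Set P2) : BundleData S :=
  ⟨L.ι, L.H, L.Hdeg, L.num, L.den, L.tdeg⟩

/-- Tensor product of invertible sheaves (product of the Čech data). -/
def tensor (L M : BundleData C) : BundleData C where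
  ι := L.ι × M.ι
  H p := L.H p.1 * M.H p.2
  Hdeg p := L.Hdeg p.1 + M.Hdeg p.2
  num p q := L.num p.1 q.1 * M.num p.2 q.2
  den p q := L.den p.1 q.1 * M.den p.2 q.2
  tdeg p q := L.tdeg p.1 q.1 + M.tdeg p.2 q.2

/-- The dual (inverse) of an invertible sheaf: invert the transition functions. -/
def dual (L : BundleData C) : BundleData C :=
  ⟨L.ι, L.H, L.Hdeg, L.den, L.num, L.tdeg⟩

end BundleData

/-- The structure sheaf `𝒪_C` as Čech data: one chart, transition function `1`. -/
def trivBundle (C : Set P2) : BundleData C :=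
  ⟨Unit, fun _ => 1, fun _ => 0, fun _ _ => 1, fun _ _ => 1, fun _ _ => 0⟩

/-- The restriction `𝒪_{ℙ²}(d)|_C`: charts are the standard coordinate charts,
with transition functions `g_{ab} = (X b / X a)^d` (so that a homogeneous polynomial `G` of degree `d` gives the global section with components `G / X_a^d`). -/
def OdC (C : Set P2) (d : ℕ) : BundleData C where
  ι := Fin 3
  H a := MvPolynomial.X a
  Hdeg _ := 1
  num _ b := MvPolynomial.X b ^ d
  den a _ := MvPolynomial.X a ^ d
  tdeg _ _ := d

/-- Data of a trivialization of (equivalently, of a nowhere vanishing section of, or of a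
section of) an invertible sheaf `L` on `C`: a refined cover by complements of zero loci of
the `K c`, a map `toChart` sending each refined chart into a chart of `L`, and on each
refined chart a degree-zero rational function `lnum c / lden c` (the component of the
section in the chart `toChart c`). -/
structure TrivData {C : Set P2} (L : BundleData C) where
  σ : Type
  K : σ → MvPolynomial (Fin 3) ℂ
  Kdeg : σ → ℕ
  toChart : σ → L.ι
  lnum : σ → MvPolynomial (Fin 3) ℂ
  lden : σ → MvPolynomial (Fin 3) ℂ
  ldeg : σ → ℕ

namespace TrivData

variable {C : Set P2} {L : BundleData C}

/-- The value at `x` of the component of the section on the refined chart `c`. -/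
def lval (T : TrivData L) (c : T.σ) (x : P2) : ℂ :=
  pev (T.lnum c) x / pev (T.lden c) x

/-- `T` is a valid global section of `L`: the refined charts cover `C` and lie inside the
corresponding charts of `L`, the components are degree-zero rational functions regular on
the refined charts, with nonvanishing denominators, and they transform via the transition
functions of `L` (written multiplied out). -/
def ValidSection (T : TrivData L) : Prop :=
  (∀ c, (T.K c).IsHomogeneous (T.Kdeg c)) ∧
  (∀ x ∈ C, ∃ c, pev (T.K c) x ≠ 0) ∧
  (∀ c, ∀ x ∈ C, pev (T.K c) x ≠ 0 → pev (L.H (T.toChart c)) x ≠ 0) ∧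
  (∀ c, (T.lnum c).IsHomogeneous (T.ldeg c) ∧ (T.lden c).IsHomogeneous (T.ldeg c)) ∧
  (∀ c, ∀ x ∈ C, pev (T.K c) x ≠ 0 → pev (T.lden c) x ≠ 0) ∧
  (∀ c c', ∀ x ∈ C, pev (T.K c) x ≠ 0 → pev (T.K c') x ≠ 0 →
    pev (L.num (T.toChart c) (T.toChart c')) x * pev (T.lnum c') x * pev (T.lden c) x
      = pev (L.den (T.toChart c) (T.toChart c')) x * pev (T.lden c') x * pev (T.lnum c) x)

/-- `T` is a valid trivialization of `L`: a global section which moreover vanishes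
nowhere on `C`. -/
def Valid (T : TrivData L) : Prop :=
  T.ValidSection ∧ ∀ c, ∀ x ∈ C, pev (T.K c) x ≠ 0 → pev (T.lnum c) x ≠ 0

end TrivData

/-- An invertible sheaf is trivial if it admits a nowhere vanishing global section. -/
def IsTrivial {C : Set P2} (L : BundleData C) : Prop :=
  ∃ T : TrivData L, T.Valid

/-- Two invertible sheaves on `C` are isomorphic iff `L ⊗ M^∨` is trivial. -/
def BIso {C : Set P2} (L M : BundleData C) : Prop :=
  IsTrivial (L.tensor M.dual)

/-- An invertible sheaf has order two (in the sense `ℱ ⊗ ℱ ≅ 𝒪_C`). -/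
def IsOrderTwo {C : Set P2} (L : BundleData C) : Prop :=
  BIso (L.tensor L) (trivBundle C)

end Bundles

section SheafGluing

/-- The sign `±1 ∈ ℂ` attached to an element of `{+,-}` (`true` is `+`). -/
def signC (b : Bool) : ℂ := if b then 1 else -1

/-- `κ` is the gluing data of the invertible sheaf `L` of order two on the conic-line
arrangement `C = C₁ + ⋯ + C_k`: there are trivializations of the restrictions `L|_{C_i}`
such that at each node `Q ∈ C_i ∩ C_j` the two trivializing sections, compared in any chart
of `L` at `Q`, differ by the factor `+1` if `κ(Q) = +` and `-1` if `κ(Q) = -`. -/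
def IsSheafGluingDataOf {k : ℕ} (A : ConicLineArrangement k)
    (L : BundleData A.plane) (κ : GluingData A) : Prop :=
  ∃ T : (i : Fin k) → TrivData (L.restrict (A.curve i)),
    (∀ i, (T i).Valid) ∧
    ∀ (Q : {Q : P2 // Q ∈ A.sing}) (i j : Fin k), i ≠ j →
      (Q : P2) ∈ A.curve i → (Q : P2) ∈ A.curve j →
      ∀ a : L.ι, pev (L.H a) (Q : P2) ≠ 0 →
      ∀ (c : (T i).σ) (c' : (T j).σ),
        pev ((T i).K c) (Q : P2) ≠ 0 → pev ((T j).K c') (Q : P2) ≠ 0 →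
        (L.restrict (A.curve i)).gval a ((T i).toChart c) (Q : P2) * (T i).lval c (Q : P2)
          = signC (κ Q) *
            ((L.restrict (A.curve j)).gval a ((T j).toChart c') (Q : P2)
              * (T j).lval c' (Q : P2))

end SheafGluing

section Divisors

/-- The homogeneous ideal of a point `P ∈ ℙ²(ℂ)`: the ideal generated by the linear forms
vanishing at `P`. -/
def pointIdeal (P : P2) : Ideal (MvPolynomial (Fin 3) ℂ) :=
  Ideal.span {l : MvPolynomial (Fin 3) ℂ | l.IsHomogeneous 1 ∧ pev l P = 0}

/-- `OrdGE f P G m`: on the curve `{f = 0}`, the restriction of the homogeneous polynomial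
`G` vanishes to order at least `m` at the point `P`: after multiplying by some homogeneous
polynomial nonvanishing at `P` (i.e. a unit in the local ring of `ℙ²` at `P`), `G` belongs
to the ideal generated by `f` and the `m`-th power of the homogeneous ideal of `P`. -/
def OrdGE (f : MvPolynomial (Fin 3) ℂ) (P : P2) (G : MvPolynomial (Fin 3) ℂ) (m : ℕ) : Prop :=
  ∃ (Hl : MvPolynomial (Fin 3) ℂ) (e : ℕ), Hl.IsHomogeneous e ∧ pev Hl P ≠ 0 ∧
    Hl * G ∈ Ideal.span {f} ⊔ pointIdeal P ^ m

/-- `OrdEq f P G m`: on the curve `{f = 0}`, the restriction of `G` vanishes to order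
exactly `m` at `P`. -/
def OrdEq (f : MvPolynomial (Fin 3) ℂ) (P : P2) (G : MvPolynomial (Fin 3) ℂ) (m : ℕ) : Prop :=
  OrdGE f P G m ∧ ¬ OrdGE f P G (m + 1)

/-- The divisor of the global section `s` of an invertible sheaf on the curve
`C = {f = 0}` equals the effective divisor `D` (a finitely supported function `ℙ² →₀ ℕ`):
at every point `P` of `C`, in any chart of `s` at `P`, the numerator of the component of
`s` vanishes on `C` to order exactly `D P` at `P` (the denominator does not vanish at `P`). -/
def DivisorOfSectionEq (C : Set P2) (f : MvPolynomial (Fin 3) ℂ) {L : BundleData C}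
    (s : TrivData L) (D : P2 →₀ ℕ) : Prop :=
  (∀ P : P2, D P ≠ 0 → P ∈ C) ∧
  ∀ P ∈ C, ∀ c : s.σ, pev (s.K c) P ≠ 0 → OrdEq f P (s.lnum c) (D P)

/-- The invertible sheaf `L` on the curve `C = {f = 0}` has a global section with divisor
exactly `D`; equivalently, `L ≅ 𝒪_C(D)`. -/
def HasSectionWithDivisor (C : Set P2) (f : MvPolynomial (Fin 3) ℂ)
    (L : BundleData C) (D : P2 →₀ ℕ) : Prop :=
  ∃ s : TrivData L, s.ValidSection ∧ DivisorOfSectionEq C f s D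

/-- `L ≅ 𝒪_{ℙ²}(d)|_C ⊗ 𝒪_C(-D)`: the invertible sheaf `L^∨ ⊗ 𝒪(d)|_C` on `C = {f = 0}`
has a global section with divisor exactly `D`. -/
def RepOdMinus (C : Set P2) (f : MvPolynomial (Fin 3) ℂ) (d : ℕ)
    (L : BundleData C) (D : P2 →₀ ℕ) : Prop :=
  HasSectionWithDivisor C f ((L.dual).tensor (OdC C d)) D

/-- The dualizing sheaf of a reduced plane curve `C ⊂ ℙ²` of degree `m`: by adjunction it is
`ω_C = 𝒪_{ℙ²}(m - 3)|_C`. -/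
def planeCurveDualizing (C : Set P2) (m : ℕ) : BundleData C := OdC C (m - 3)

end Divisors

section Tangency

/-- The line `{l = 0}` is tangent to the curve `{g = 0}` at the point `P`: `P` lies on both
and the gradients are proportional there. -/
def IsTangentLineAt (l g : MvPolynomial (Fin 3) ℂ) (P : P2) : Prop :=
  pev l P = 0 ∧ pev g P = 0 ∧
  ∃ c : ℂ, ∀ m : Fin 3, pev (MvPolynomial.pderiv m g) P = c * pev (MvPolynomial.pderiv m l) P

open Classical in
/-- `D` is the divisor `w·P_{i1} + w·P_{i2}` for the tangency points `P_{ik}` of the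
bitangent line `T_i`. -/
def IsTangencyDivisorAt (Pt : Fin 4 → Fin 2 → P2) (i : Fin 4) (w : ℕ) (D : P2 →₀ ℕ) : Prop :=
  ∀ P : P2, D P = (if P = Pt i 0 then w else 0) + (if P = Pt i 1 then w else 0)

open Classical in
/-- `D` is the divisor `P_{i1} + P_{i2} + P_{j1} + P_{j2}` of the tangency points of the two
bitangent lines `T_i`, `T_j`. -/
def IsTangencyDivisor (Pt : Fin 4 → Fin 2 → P2) (i j : Fin 4) (D : P2 →₀ ℕ) : Prop :=
  ∀ P : P2, D P = (if P = Pt i 0 then 1 else 0) + (if P = Pt i 1 then 1 else 0)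
    + (if P = Pt j 0 then 1 else 0) + (if P = Pt j 1 then 1 else 0)

end Tangency

lemma eval_smul_of_isHomogeneous {g : MvPolynomial (Fin 3) ℂ} {n : ℕ} (hg : g.IsHomogeneous n)
    (c : ℂ) (v : Fin 3 → ℂ) : eval (c • v) g = c ^ n * eval v g := by
  rw [eval_eq, eval_eq, Finset.mul_sum]
  refine Finset.sum_congr rfl fun d hd => ?_
  have h : d.degree = n := by
    by_contra h
    exact (mem_support_iff.mp hd) (hg.coeff_eq_zero h)
  simp only [Pi.smul_apply, smul_eq_mul, mul_pow, Finset.prod_mul_distrib]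
  rw [Finset.prod_pow_eq_pow_sum, show ∑ i ∈ d.support, d i = n from h]
  ring

lemma rep_mk {v : Fin 3 → ℂ} (hv : v ≠ 0) :
    ∃ c : ℂ, c ≠ 0 ∧ (Projectivization.mk ℂ v hv).rep = c • v := by
  obtain ⟨a, ha⟩ := Projectivization.exists_smul_eq_mk_rep ℂ v hv
  exact ⟨a, a.ne_zero, ha.symm⟩

lemma pev_mk_eq_zero {g : MvPolynomial (Fin 3) ℂ} {n : ℕ} (hg : g.IsHomogeneous n)
    {v : Fin 3 → ℂ} (hv : v ≠ 0) :
    pev g (Projectivization.mk ℂ v hv) = 0 ↔ eval v g = 0 := by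
  obtain ⟨c, hc, h⟩ := rep_mk hv
  rw [pev, h, eval_smul_of_isHomogeneous hg]
  simp [hc]

@[simp] lemma pev_mul (g h : MvPolynomial (Fin 3) ℂ) (x : P2) :
    pev (g * h) x = pev g x * pev h x := by simp [pev]

@[simp] lemma pev_add (g h : MvPolynomial (Fin 3) ℂ) (x : P2) :
    pev (g + h) x = pev g x + pev h x := by simp [pev]

@[simp] lemma pev_sub (g h : MvPolynomial (Fin 3) ℂ) (x : P2) :
    pev (g - h) x = pev g x - pev h x := by simp [pev]

@[simp] lemma pev_neg (g : MvPolynomial (Fin 3) ℂ) (x : P2) :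
    pev (-g) x = -pev g x := by simp [pev]

@[simp] lemma pev_pow (g : MvPolynomial (Fin 3) ℂ) (n : ℕ) (x : P2) :
    pev (g ^ n) x = pev g x ^ n := by simp [pev]

@[simp] lemma pev_one (x : P2) : pev 1 x = 1 := by simp [pev]

@[simp] lemma pev_C (c : ℂ) (x : P2) : pev (C c) x = c := by simp [pev]

lemma pev_X (m : Fin 3) (x : P2) : pev (X m) x = x.rep m := by simp [pev]

lemma exists_pev_X_ne_zero (x : P2) : ∃ m : Fin 3, pev (X m) x ≠ 0 := by
  by_contra! h
  exact x.rep_nonzero (funext fun m => by simpa [pev_X] using h m)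

lemma eval_eq_sum_of_isHomogeneous_one {g : MvPolynomial (Fin 3) ℂ} (hg : g.IsHomogeneous 1) :
    ∃ a : Fin 3 → ℂ, g = ∑ m, C (a m) * X m ∧ ∀ m, pderiv m g = C (a m) := by
  have h0 : ∀ m, ∃ a : ℂ, pderiv m g = C a := fun m => by
    have h := hg.pderiv (i := m)
    rw [Nat.sub_self] at h
    have := (totalDegree_zero_iff_isHomogeneous (σ := Fin 3)).mpr h
    exact ⟨_, totalDegree_eq_zero_iff_eq_C.mp this⟩
  choose a ha using h0
  refine ⟨a, ?_, ha⟩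
  have := hg.sum_X_mul_pderiv
  rw [one_smul] at this
  rw [← this]
  exact Finset.sum_congr rfl fun m _ => by rw [ha, mul_comm]

/-- The linear functional defined by a homogeneous polynomial of degree one. -/
def linearFunctional (g : MvPolynomial (Fin 3) ℂ) (hg : g.IsHomogeneous 1) :
    (Fin 3 → ℂ) →ₗ[ℂ] ℂ where
  toFun v := eval v g
  map_add' v w := by
    obtain ⟨a, ha, -⟩ := eval_eq_sum_of_isHomogeneous_one hg
    simp only [ha, map_sum, map_mul, eval_C, eval_X, Pi.add_apply, mul_add, Finset.sum_add_distrib]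
  map_smul' c v := by
    simpa using eval_smul_of_isHomogeneous hg c v

@[simp] lemma linearFunctional_apply {g : MvPolynomial (Fin 3) ℂ} (hg : g.IsHomogeneous 1)
    (v : Fin 3 → ℂ) : linearFunctional g hg v = eval v g := rfl

lemma eval_eq_sum_pderiv {g : MvPolynomial (Fin 3) ℂ} (hg : g.IsHomogeneous 1)
    (v w : Fin 3 → ℂ) : eval w g = ∑ m, eval v (pderiv m g) * w m := by
  obtain ⟨a, ha, hd⟩ := eval_eq_sum_of_isHomogeneous_one hg
  simp only [hd, eval_C]
  conv_lhs => rw [ha]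
  simp

/-- The derivative of `g` at `v` in the direction `w`. -/
def polar (g : MvPolynomial (Fin 3) ℂ) (v w : Fin 3 → ℂ) : ℂ := ∑ m, eval v (pderiv m g) * w m

lemma polar_add_right (g : MvPolynomial (Fin 3) ℂ) (u v w : Fin 3 → ℂ) :
    polar g u (v + w) = polar g u v + polar g u w := by
  simp [polar, mul_add, Finset.sum_add_distrib]

lemma polar_smul_right (g : MvPolynomial (Fin 3) ℂ) (c : ℂ) (v w : Fin 3 → ℂ) :
    polar g v (c • w) = c * polar g v w := by
  simp only [polar, Finset.mul_sum, Pi.smul_apply, smul_eq_mul]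
  exact Finset.sum_congr rfl fun _ _ => by ring

lemma pderiv_pderiv_comm (g : MvPolynomial (Fin 3) ℂ) (m n : Fin 3) :
    pderiv m (pderiv n g) = pderiv n (pderiv m g) := by
  have h : ⁅(pderiv m : Derivation ℂ (MvPolynomial (Fin 3) ℂ) (MvPolynomial (Fin 3) ℂ)),
      (pderiv n : Derivation ℂ (MvPolynomial (Fin 3) ℂ) (MvPolynomial (Fin 3) ℂ))⁆ = 0 := by
    refine derivation_ext fun k => ?_
    rw [Derivation.commutator_apply, pderiv_X, pderiv_X]
    simp only [Pi.single_apply]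
    split_ifs <;> simp
  have := congrArg (fun D : Derivation ℂ (MvPolynomial (Fin 3) ℂ) (MvPolynomial (Fin 3) ℂ) => D g) h
  rwa [Derivation.commutator_apply, Derivation.zero_apply, sub_eq_zero] at this

lemma polar_comm {g : MvPolynomial (Fin 3) ℂ} (hg : g.IsHomogeneous 2) (v w : Fin 3 → ℂ) :
    polar g v w = polar g w v := by
  have h : ∀ m, ∃ a : Fin 3 → ℂ, pderiv m g = ∑ n, C (a n) * X n ∧
      ∀ n, pderiv n (pderiv m g) = C (a n) := fun m =>
    eval_eq_sum_of_isHomogeneous_one (hg.pderiv (i := m))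
  choose a ha hd using h
  have hs : ∀ m n, a m n = a n m := fun m n => by
    have h := pderiv_pderiv_comm g m n
    rw [hd, hd] at h
    exact (C_injective _ _ h).symm
  have he : ∀ m u, eval u (pderiv m g) = ∑ n, a m n * u n := fun m u => by simp [ha]
  simp only [polar, he, Fin.sum_univ_three]
  rw [hs 1 0, hs 2 0, hs 2 1]
  ring

lemma polar_self {g : MvPolynomial (Fin 3) ℂ} (hg : g.IsHomogeneous 2) (v : Fin 3 → ℂ) :
    polar g v v = 2 * eval v g := by
  have h := congrArg (eval v) hg.sum_X_mul_pderiv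
  simp only [map_sum, map_mul, eval_X, nsmul_eq_mul, map_natCast] at h
  rw [polar, ← Nat.cast_two, ← h]
  exact Finset.sum_congr rfl fun _ _ => mul_comm _ _

lemma polar_add_left {g : MvPolynomial (Fin 3) ℂ} (hg : g.IsHomogeneous 2) (u v w : Fin 3 → ℂ) :
    polar g (u + v) w = polar g u w + polar g v w := by
  rw [polar_comm hg, polar_add_right, polar_comm hg w, polar_comm hg w]

lemma polar_smul_left {g : MvPolynomial (Fin 3) ℂ} (hg : g.IsHomogeneous 2) (c : ℂ)
    (v w : Fin 3 → ℂ) : polar g (c • v) w = c * polar g v w := by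
  rw [polar_comm hg, polar_smul_right, polar_comm hg w]

lemma aeval_smul_const {R : Type*} [CommRing R] [Algebra ℂ R] {g : MvPolynomial (Fin 3) ℂ} {n : ℕ}
    (hg : g.IsHomogeneous n) (p : Fin 3 → ℂ) (z : R) :
    aeval (fun m => p m • z) g = eval p g • z ^ n := by
  rw [aeval_def, eval₂_eq, eval_eq, Finset.sum_smul]
  refine Finset.sum_congr rfl fun d hd => ?_
  have hdn : ∑ i ∈ d.support, d i = n := by
    by_contra h
    exact (mem_support_iff.mp hd) (hg.coeff_eq_zero h)
  rw [← Algebra.smul_def, mul_smul, ← hdn, ← Finset.prod_pow_eq_pow_sum]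
  simp only [Algebra.smul_def, mul_pow, Finset.prod_mul_distrib, map_prod, map_pow]

/-- A homogeneous polynomial vanishing at a point lies in the homogeneous ideal of the point. -/
lemma mem_pointIdeal {g : MvPolynomial (Fin 3) ℂ} {n : ℕ} (hg : g.IsHomogeneous n) {P : P2}
    (h : pev g P = 0) : g ∈ pointIdeal P := by
  obtain ⟨e, he⟩ := exists_pev_X_ne_zero P
  rw [pev_X] at he
  have key : ∀ (R : Type) [CommRing R] [Algebra ℂ R] (φ : MvPolynomial (Fin 3) ℂ →ₐ[ℂ] R),
      (∀ a ∈ pointIdeal P, φ a = 0) → φ g = 0 := by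
    intro R _ _ φ hφ
    have hX : ∀ m, φ (X m) = P.rep m • ((P.rep e)⁻¹ • φ (X e)) := by
      intro m
      have hm : (X m - C (P.rep m * (P.rep e)⁻¹) * X e : MvPolynomial (Fin 3) ℂ)
          ∈ pointIdeal P := by
        refine Ideal.subset_span ⟨?_, ?_⟩
        · exact (isHomogeneous_X ℂ m).sub (isHomogeneous_C_mul_X _ e)
        · simp [pev_X, he]
      have := hφ _ hm
      rwa [C_mul', map_sub, sub_eq_zero, map_smul, mul_smul] at this
    rw [aeval_unique φ, show (φ ∘ X) = fun m => P.rep m • ((P.rep e)⁻¹ • φ (X e)) from funext hX,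
      aeval_smul_const hg, show eval P.rep g = 0 from h, zero_smul]
  have := key _ (Ideal.Quotient.mkₐ ℂ (pointIdeal P)) fun a ha =>
    Ideal.Quotient.eq_zero_iff_mem.mpr ha
  exact Ideal.Quotient.eq_zero_iff_mem.mp this

lemma homogeneousComponent_mul_left {g h : MvPolynomial (Fin 3) ℂ} {d n : ℕ}
    (hg : g.IsHomogeneous d) (hd : d ≤ n) :
    homogeneousComponent n (g * h) = g * homogeneousComponent (n - d) h := by
  conv_lhs => rw [← sum_homogeneousComponent h, Finset.mul_sum, map_sum]
  have : ∀ i, homogeneousComponent n (g * homogeneousComponent i h) =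
      if i = n - d then g * homogeneousComponent i h else 0 := fun i => by
    rw [homogeneousComponent_of_mem (hg.mul (homogeneousComponent_isHomogeneous i h))]
    exact if_congr (by omega) rfl rfl
  simp only [this, Finset.sum_ite_eq', Finset.mem_range]
  split_ifs with hlt
  · rfl
  · rw [homogeneousComponent_eq_zero _ _ (by omega), mul_zero]

/-- Near `x`, the function `g` agrees on `S`, away from the zeros of `b`, with a ratio of
homogeneous polynomials of the same degree which is regular and nonzero at `x`. -/
def UnitRegAt (S : Set P2) (b : MvPolynomial (Fin 3) ℂ) (g : P2 → ℂ) (x : P2) : Prop :=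
  ∃ (p q : MvPolynomial (Fin 3) ℂ) (d : ℕ), p.IsHomogeneous d ∧ q.IsHomogeneous d ∧
    pev p x ≠ 0 ∧ pev q x ≠ 0 ∧
    ∀ y ∈ S, pev b y ≠ 0 → pev p y ≠ 0 → pev q y ≠ 0 → g y = pev p y / pev q y

namespace UnitRegAt

variable {S S' : Set P2} {b : MvPolynomial (Fin 3) ℂ} {g g' : P2 → ℂ} {x : P2}

lemma congr_of_subset (h : UnitRegAt S b g x) {K : MvPolynomial (Fin 3) ℂ} {e : ℕ}
    (hK : K.IsHomogeneous e) (hKx : pev K x ≠ 0)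
    (hS : ∀ y ∈ S', pev b y ≠ 0 → pev K y ≠ 0 → y ∈ S ∧ g' y = g y) : UnitRegAt S' b g' x := by
  obtain ⟨p, q, d, hp, hq, hpx, hqx, hg⟩ := h
  refine ⟨p * K, q * K, d + e, hp.mul hK, hq.mul hK, by simp [hpx, hKx], by simp [hqx, hKx], ?_⟩
  intro y hy hb h1 h2
  simp only [pev_mul, ne_eq, mul_eq_zero, not_or] at h1 h2
  obtain ⟨hyS, hgy⟩ := hS y hy hb h1.2
  rw [hgy, hg y hyS hb h1.1 h2.1, pev_mul, pev_mul, mul_div_mul_right _ _ h1.2]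

lemma congr (h : UnitRegAt S b g x) {K : MvPolynomial (Fin 3) ℂ} {e : ℕ}
    (hK : K.IsHomogeneous e) (hKx : pev K x ≠ 0)
    (hS : ∀ y ∈ S, pev b y ≠ 0 → pev K y ≠ 0 → g' y = g y) : UnitRegAt S b g' x :=
  h.congr_of_subset hK hKx fun y hy hb hKy => ⟨hy, hS y hy hb hKy⟩

lemma mul (h : UnitRegAt S b g x) (h' : UnitRegAt S b g' x) :
    UnitRegAt S b (fun y => g y * g' y) x := by
  obtain ⟨p, q, d, hp, hq, hpx, hqx, hg⟩ := h
  obtain ⟨p', q', d', hp', hq', hpx', hqx', hg'⟩ := h'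
  refine ⟨p * p', q * q', d + d', hp.mul hp', hq.mul hq', by simp [hpx, hpx'],
    by simp [hqx, hqx'], ?_⟩
  intro y hy hb h1 h2
  simp only [pev_mul, ne_eq, mul_eq_zero, not_or] at h1 h2
  simp only [pev_mul]
  rw [hg y hy hb h1.1 h2.1, hg' y hy hb h1.2 h2.2, div_mul_div_comm]

lemma inv (h : UnitRegAt S b g x) : UnitRegAt S b (fun y => (g y)⁻¹) x := by
  obtain ⟨p, q, d, hp, hq, hpx, hqx, hg⟩ := h
  refine ⟨q, p, d, hq, hp, hqx, hpx, fun y hy hb h1 h2 => ?_⟩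
  beta_reduce
  rw [hg y hy hb h2 h1, inv_div]

lemma div (h : UnitRegAt S b g x) (h' : UnitRegAt S b g' x) :
    UnitRegAt S b (fun y => g y / g' y) x := by
  simpa only [div_eq_mul_inv] using h.mul h'.inv

lemma of_ratio {p q K : MvPolynomial (Fin 3) ℂ} {d e : ℕ} (hp : p.IsHomogeneous d)
    (hq : q.IsHomogeneous d) (hK : K.IsHomogeneous e) (hpx : pev p x ≠ 0) (hqx : pev q x ≠ 0)
    (hKx : pev K x ≠ 0)
    (h : ∀ y ∈ S, pev b y ≠ 0 → pev p y ≠ 0 → pev q y ≠ 0 → pev K y ≠ 0 →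
      g y = pev p y / pev q y) : UnitRegAt S b g x := by
  refine ⟨p * K, q * K, d + e, hp.mul hK, hq.mul hK, by simp [hpx, hKx], by simp [hqx, hKx], ?_⟩
  intro y hy hb h1 h2
  simp only [pev_mul, ne_eq, mul_eq_zero, not_or] at h1 h2
  rw [h y hy hb h1.1 h2.1 h1.2, pev_mul, pev_mul, mul_div_mul_right _ _ h1.2]

end UnitRegAt

lemma ratio_const (h : ℂ → ℂ) (b : Polynomial ℂ) (hb : b ≠ 0)
    (H : ∀ t₀, ∃ p q : Polynomial ℂ, p.eval t₀ ≠ 0 ∧ q.eval t₀ ≠ 0 ∧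
      ∀ t, b.eval t ≠ 0 → p.eval t ≠ 0 → q.eval t ≠ 0 → h t = p.eval t / q.eval t)
    {t₁ t₂ : ℂ} (h₁ : b.eval t₁ ≠ 0) (h₂ : b.eval t₂ ≠ 0) : h t₁ = h t₂ := by
  classical
  obtain ⟨p₀, q₀, hp₀, hq₀, hh₀⟩ := H 0
  have hp₀' : p₀ ≠ 0 := by rintro rfl; simp at hp₀
  have hq₀' : q₀ ≠ 0 := by rintro rfl; simp at hq₀
  obtain ⟨p, q, hcop, hpq⟩ : ∃ p q : Polynomial ℂ, IsCoprime p q ∧ p₀ * q = p * q₀ := by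
    have hg : EuclideanDomain.gcd p₀ q₀ ≠ 0 :=
      fun h => hp₀' (EuclideanDomain.gcd_eq_zero_iff.mp h).1
    obtain ⟨p, e1⟩ := EuclideanDomain.gcd_dvd_left p₀ q₀
    obtain ⟨q, e2⟩ := EuclideanDomain.gcd_dvd_right p₀ q₀
    have hb := EuclideanDomain.gcd_eq_gcd_ab p₀ q₀
    set A := EuclideanDomain.gcdA p₀ q₀
    set B := EuclideanDomain.gcdB p₀ q₀
    set D := EuclideanDomain.gcd p₀ q₀
    refine ⟨p, q, ⟨A, B, mul_left_cancel₀ hg ?_⟩, ?_⟩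
    · linear_combination -hb - A * e1 - B * e2
    · linear_combination q * e1 - p * e2
  have key : ∀ t, ∃ p₁ q₁ : Polynomial ℂ, p₁.eval t ≠ 0 ∧ q₁.eval t ≠ 0 ∧
      (b.eval t ≠ 0 → h t = p₁.eval t / q₁.eval t) ∧ p₁ * q = p * q₁ := by
    intro t
    obtain ⟨p₁, q₁, hp₁, hq₁, hh₁⟩ := H t
    refine ⟨p₁, q₁, hp₁, hq₁, fun hbt => hh₁ t hbt hp₁ hq₁, ?_⟩
    have hp₁' : p₁ ≠ 0 := by rintro rfl; simp at hp₁
    have hq₁' : q₁ ≠ 0 := by rintro rfl; simp at hq₁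
    have : (b * p₀ * q₀ * p₁ * q₁) * (p₁ * q₀ - p₀ * q₁) = 0 := by
      refine Polynomial.funext fun s => ?_
      simp only [Polynomial.eval_mul, Polynomial.eval_sub, Polynomial.eval_zero]
      by_cases hs : b.eval s * p₀.eval s * q₀.eval s * p₁.eval s * q₁.eval s = 0
      · rw [hs, zero_mul]
      · simp only [mul_eq_zero, not_or] at hs
        obtain ⟨⟨⟨⟨s1, s2⟩, s3⟩, s4⟩, s5⟩ := hs
        have := (hh₀ s s1 s2 s3).symm.trans (hh₁ s s1 s4 s5)
        rw [div_eq_div_iff s3 s5] at this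
        rw [this]
        ring
    have h0 := (mul_eq_zero.mp this).resolve_left (by simp [hb, hp₀', hq₀', hp₁', hq₁'])
    apply mul_left_cancel₀ (mul_ne_zero hp₀' hq₀')
    linear_combination p₀ * q * h0 + q₁ * p₀ * hpq
  have hunit : ∀ r s : Polynomial ℂ, IsCoprime r s →
      (∀ t, ∃ r₁ s₁ : Polynomial ℂ, r₁.eval t ≠ 0 ∧ s₁.eval t ≠ 0 ∧ r₁ * s = r * s₁) →
      ∃ a, a ≠ 0 ∧ r = Polynomial.C a := by
    intro r s hrs hk
    have hroot : ∀ t, r.eval t ≠ 0 := by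
      intro t ht
      obtain ⟨r₁, s₁, hr₁, hs₁, he⟩ := hk t
      have h1 := congrArg (Polynomial.eval t) he
      simp only [Polynomial.eval_mul, ht, zero_mul] at h1
      have hst := (mul_eq_zero.mp h1).resolve_left hr₁
      obtain ⟨u, v, huv⟩ := hrs
      have := congrArg (Polynomial.eval t) huv
      simp [ht, hst] at this
    have hdeg : r.degree = 0 := by
      by_contra hd
      obtain ⟨t, ht⟩ := IsAlgClosed.exists_root r hd
      exact hroot t ht
    refine ⟨r.coeff 0, fun h0 => hroot 0 ?_, Polynomial.eq_C_of_degree_eq_zero hdeg⟩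
    rw [Polynomial.eq_C_of_degree_eq_zero hdeg, h0]
    simp
  obtain ⟨a, ha, rfl⟩ := hunit p q hcop fun t => by
    obtain ⟨p₁, q₁, h1, h2, -, h3⟩ := key t
    exact ⟨p₁, q₁, h1, h2, h3⟩
  obtain ⟨c, hc, rfl⟩ := hunit q (Polynomial.C a) hcop.symm fun t => by
    obtain ⟨p₁, q₁, h1, h2, -, h3⟩ := key t
    exact ⟨q₁, p₁, h2, h1, by rw [mul_comm, ← h3, mul_comm]⟩
  have hval : ∀ t, b.eval t ≠ 0 → h t = a / c := by
    intro t ht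
    obtain ⟨p₁, q₁, h1, h2, h3, h4⟩ := key t
    rw [h3 ht, div_eq_div_iff h2 hc]
    simpa using congrArg (Polynomial.eval t) h4
  rw [hval _ h₁, hval _ h₂]

/-- Coordinates adapted to a conic and two of its tangent lines `l`, `l'`: the conic is
`l * l' = M ^ 2` with `l`, `l'`, `M` linearly independent. -/
structure ConicFrame (F l l' : MvPolynomial (Fin 3) ℂ) where
  M : MvPolynomial (Fin 3) ℂ
  κ : ℂ
  e₁ : Fin 3 → ℂ
  e₂ : Fin 3 → ℂ
  e₃ : Fin 3 → ℂ
  hl : l.IsHomogeneous 1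
  hl' : l'.IsHomogeneous 1
  hM : M.IsHomogeneous 1
  hκ : κ ≠ 0
  eqn : F = C κ * (l * l' - M ^ 2)
  l_e₁ : eval e₁ l = 1
  l_e₂ : eval e₂ l = 0
  l_e₃ : eval e₃ l = 0
  l'_e₁ : eval e₁ l' = 0
  l'_e₂ : eval e₂ l' = 1
  l'_e₃ : eval e₃ l' = 0
  M_e₁ : eval e₁ M = 0
  M_e₂ : eval e₂ M = 0
  M_e₃ : eval e₃ M = 1
  span : ∀ v, v = eval v l • e₁ + eval v l' • e₂ + eval v M • e₃

namespace ConicFrame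

variable {F l l' : MvPolynomial (Fin 3) ℂ} (Φ : ConicFrame F l l')

/-- The parametrization of the conic by `l = u ^ 2`, `l' = w ^ 2`, `M = u * w`. -/
def param (u w : ℂ) : Fin 3 → ℂ := u ^ 2 • Φ.e₁ + w ^ 2 • Φ.e₂ + (u * w) • Φ.e₃

lemma eval_comb {g : MvPolynomial (Fin 3) ℂ} (hg : g.IsHomogeneous 1) (a b c : ℂ) :
    eval (a • Φ.e₁ + b • Φ.e₂ + c • Φ.e₃) g
      = a * eval Φ.e₁ g + b * eval Φ.e₂ g + c * eval Φ.e₃ g := by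
  have := (linearFunctional g hg).map_add
  simp only [← linearFunctional_apply hg, map_add, map_smul, smul_eq_mul]

lemma eval_param {g : MvPolynomial (Fin 3) ℂ} (hg : g.IsHomogeneous 1) (u w : ℂ) :
    eval (Φ.param u w) g
      = u ^ 2 * eval Φ.e₁ g + w ^ 2 * eval Φ.e₂ g + (u * w) * eval Φ.e₃ g :=
  Φ.eval_comb hg _ _ _

lemma l_param (u w : ℂ) : eval (Φ.param u w) l = u ^ 2 := by
  simp [Φ.eval_param Φ.hl, Φ.l_e₁, Φ.l_e₂, Φ.l_e₃]

lemma l'_param (u w : ℂ) : eval (Φ.param u w) l' = w ^ 2 := by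
  simp [Φ.eval_param Φ.hl', Φ.l'_e₁, Φ.l'_e₂, Φ.l'_e₃]

lemma M_param (u w : ℂ) : eval (Φ.param u w) Φ.M = u * w := by
  simp [Φ.eval_param Φ.hM, Φ.M_e₁, Φ.M_e₂, Φ.M_e₃]

lemma eval_eq_zero_iff (v : Fin 3 → ℂ) :
    eval v F = 0 ↔ eval v l * eval v l' = eval v Φ.M ^ 2 := by
  have h := congrArg (eval v) Φ.eqn
  rw [h]
  simp [Φ.hκ, sub_eq_zero]

lemma F_param (u w : ℂ) : eval (Φ.param u w) F = 0 := by
  rw [Φ.eval_eq_zero_iff, l_param, l'_param, M_param]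
  ring

lemma isHomogeneous (Φ : ConicFrame F l l') : F.IsHomogeneous 2 := by
  have h : (C Φ.κ * (l * l' - Φ.M ^ 2)).IsHomogeneous 2 :=
    ((Φ.hl.mul Φ.hl').sub (Φ.hM.pow 2)).C_mul _
  rwa [← Φ.eqn] at h

lemma param_eq_zero {u w : ℂ} (h : Φ.param u w = 0) : u = 0 ∧ w = 0 := by
  have h1 := Φ.l_param u w
  have h2 := Φ.l'_param u w
  have hz : ∀ g : MvPolynomial (Fin 3) ℂ, g.IsHomogeneous 1 → eval 0 g = 0 :=
    fun g hg => (linearFunctional g hg).map_zero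
  rw [h, hz _ Φ.hl] at h1
  rw [h, hz _ Φ.hl'] at h2
  exact ⟨by simpa using h1.symm, by simpa using h2.symm⟩

lemma exists_param {v : Fin 3 → ℂ} (hv : eval v F = 0) : ∃ u w, v = Φ.param u w := by
  rw [Φ.eval_eq_zero_iff] at hv
  obtain ⟨u, hu⟩ := IsAlgClosed.exists_pow_nat_eq (eval v l) two_pos
  by_cases h0 : u = 0
  · obtain ⟨w, hw⟩ := IsAlgClosed.exists_pow_nat_eq (eval v l') two_pos
    refine ⟨u, w, ?_⟩
    have hM : eval v Φ.M = 0 := by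
      rw [← hu, h0] at hv
      simpa using hv.symm
    conv_lhs => rw [Φ.span v, ← hu, ← hw, hM]
    simp [param, h0]
  · refine ⟨u, eval v Φ.M / u, ?_⟩
    have hw : eval v l' = (eval v Φ.M / u) ^ 2 := by
      rw [div_pow, ← hv, hu]
      have h1 : eval v l ≠ 0 := by rw [← hu]; exact pow_ne_zero _ h0
      field_simp
    conv_lhs => rw [Φ.span v, ← hu]
    rw [param, hw, mul_div_cancel₀ _ h0]

end ConicFrame

lemma eval_aeval_polynomial (c : Fin 3 → Polynomial ℂ) (g : MvPolynomial (Fin 3) ℂ) (t : ℂ) :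
    (aeval c g).eval t = eval (fun m => (c m).eval t) g := by
  rw [aeval_def, eval₂_eq, eval_eq, Polynomial.eval_finsetSum]
  simp [Polynomial.eval_prod]

lemma pev_div_mk {p q : MvPolynomial (Fin 3) ℂ} {d : ℕ} (hp : p.IsHomogeneous d)
    (hq : q.IsHomogeneous d) {v : Fin 3 → ℂ} (hv : v ≠ 0) :
    pev p (Projectivization.mk ℂ v hv) / pev q (Projectivization.mk ℂ v hv)
      = eval v p / eval v q := by
  obtain ⟨c, hc, h⟩ := rep_mk hv
  rw [pev, pev, h, eval_smul_of_isHomogeneous hp, eval_smul_of_isHomogeneous hq,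
    mul_div_mul_left _ _ (pow_ne_zero _ hc)]

/-- A nowhere vanishing regular function on a smooth conic is constant. -/
lemma ConicFrame.unitReg_const {F l l' : MvPolynomial (Fin 3) ℂ} (Φ : ConicFrame F l l')
    {b : MvPolynomial (Fin 3) ℂ} {n : ℕ} (hb : b.IsHomogeneous n) {g : P2 → ℂ}
    (hg : ∀ x ∈ zeroLocus F, UnitRegAt (zeroLocus F) b g x) {y₁ y₂ : P2}
    (h₁ : y₁ ∈ zeroLocus F) (h₂ : y₂ ∈ zeroLocus F) (hb₁ : pev b y₁ ≠ 0) (hb₂ : pev b y₂ ≠ 0) :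
    g y₁ = g y₂ := by
  obtain ⟨u₁, w₁, e₁⟩ := Φ.exists_param h₁
  obtain ⟨u₂, w₂, e₂⟩ := Φ.exists_param h₂
  have hne : ∀ y : P2, ∀ u w, y.rep = Φ.param u w → u ≠ 0 ∨ w ≠ 0 := by
    intro y u w h
    by_contra! hh
    apply y.rep_nonzero
    rw [h, hh.1, hh.2]
    simp [ConicFrame.param]
  by_cases hdet : u₁ * w₂ - u₂ * w₁ = 0
  · suffices y₁ = y₂ by rw [this]
    rw [← y₁.mk_rep, ← y₂.mk_rep, Projectivization.mk_eq_mk_iff']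
    rcases hne _ _ _ e₂ with h | h
    · refine ⟨(u₁ / u₂) ^ 2, ?_⟩
      have hw : w₁ = u₁ / u₂ * w₂ := by field_simp; linear_combination -hdet
      have hu : u₁ = u₁ / u₂ * u₂ := by field_simp
      rw [e₁, e₂]
      conv_rhs => rw [hw, hu]
      simp only [ConicFrame.param, smul_add, smul_smul]
      congr 1
      · congr 1
        · congr 1; field_simp
        · congr 1; field_simp
      · congr 1; field_simp
    · refine ⟨(w₁ / w₂) ^ 2, ?_⟩
      have hu : u₁ = w₁ / w₂ * u₂ := by field_simp; linear_combination hdet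
      have hw : w₁ = w₁ / w₂ * w₂ := by field_simp
      rw [e₁, e₂]
      conv_rhs => rw [hu, hw]
      simp only [ConicFrame.param, smul_add, smul_smul]
      congr 1
      · congr 1
        · congr 1; field_simp
        · congr 1; field_simp
      · congr 1; field_simp
  · set U : Polynomial ℂ := Polynomial.C u₁ + Polynomial.C (u₂ - u₁) * Polynomial.X with hU
    set W : Polynomial ℂ := Polynomial.C w₁ + Polynomial.C (w₂ - w₁) * Polynomial.X with hW
    set c : Fin 3 → Polynomial ℂ := fun m => U ^ 2 * Polynomial.C (Φ.e₁ m)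
      + W ^ 2 * Polynomial.C (Φ.e₂ m) + U * W * Polynomial.C (Φ.e₃ m) with hc
    have hcv : ∀ t, (fun m => (c m).eval t) = Φ.param (U.eval t) (W.eval t) := by
      intro t
      funext m
      simp [hc, ConicFrame.param]
    have hv : ∀ t, Φ.param (U.eval t) (W.eval t) ≠ 0 := by
      intro t h0
      obtain ⟨hu0, hw0⟩ := Φ.param_eq_zero h0
      apply hdet
      simp only [hU, hW, Polynomial.eval_add, Polynomial.eval_mul, Polynomial.eval_C,
        Polynomial.eval_X] at hu0 hw0
      linear_combination (w₂ - w₁) * hu0 - (u₂ - u₁) * hw0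
    have hpt : ∀ t, Projectivization.mk ℂ _ (hv t) ∈ zeroLocus F := fun t =>
      (pev_mk_eq_zero Φ.isHomogeneous (hv t)).mpr (Φ.F_param _ _)
    have hy₁ : Projectivization.mk ℂ _ (hv 0) = y₁ := by
      conv_rhs => rw [← y₁.mk_rep]
      congr 1
      simp [hU, hW, e₁]
    have hy₂ : Projectivization.mk ℂ _ (hv 1) = y₂ := by
      conv_rhs => rw [← y₂.mk_rep]
      congr 1
      simp [hU, hW, e₂]
    have hev : ∀ (p : MvPolynomial (Fin 3) ℂ) (d : ℕ), p.IsHomogeneous d → ∀ t,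
        ((aeval c p).eval t ≠ 0 ↔ pev p (Projectivization.mk ℂ _ (hv t)) ≠ 0) := by
      intro p d hp t
      rw [eval_aeval_polynomial, hcv, not_iff_not, pev_mk_eq_zero hp]
    have hb0 : (aeval c b).eval 0 ≠ 0 := by rw [hev b n hb, hy₁]; exact hb₁
    have hb1 : (aeval c b).eval 1 ≠ 0 := by rw [hev b n hb, hy₂]; exact hb₂
    have := ratio_const (fun t => g (Projectivization.mk ℂ _ (hv t))) (aeval c b)
      (by rintro h; rw [h] at hb0; simp at hb0) (fun t₀ => by
        obtain ⟨p, q, d, hp, hq, hpx, hqx, hg⟩ := hg _ (hpt t₀)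
        refine ⟨aeval c p, aeval c q, (hev p d hp t₀).mpr hpx, (hev q d hq t₀).mpr hqx, ?_⟩
        intro t h1 h2 h3
        rw [hg _ (hpt t) ((hev b n hb t).mp h1) ((hev p d hp t).mp h2) ((hev q d hq t).mp h3),
          pev_div_mk hp hq, eval_aeval_polynomial, eval_aeval_polynomial, hcv]) hb0 hb1
    simpa only [hy₁, hy₂] using this

/-- Gluing local units into a trivialization. The compatibility at the zeros of `b` is
guaranteed by choosing charts which contain at most one such zero. -/
lemma isTrivial_of_unitReg {S : Set P2} {N : BundleData S} (hN : N.Valid)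
    {b : MvPolynomial (Fin 3) ℂ} (t : N.ι → P2 → ℂ)
    (ht : ∀ a a', ∀ y ∈ S, pev b y ≠ 0 → pev (N.H a) y ≠ 0 → pev (N.H a') y ≠ 0 →
      t a y = N.gval a a' y * t a' y)
    (hreg : ∀ x ∈ S, ∀ a, pev (N.H a) x ≠ 0 → UnitRegAt S b (t a) x)
    (hsep : ∀ x ∈ S, ∃ (G : MvPolynomial (Fin 3) ℂ) (e : ℕ), G.IsHomogeneous e ∧ pev G x ≠ 0 ∧
      ∀ y ∈ S, pev b y = 0 → pev G y ≠ 0 → y = x) : IsTrivial N := by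
  obtain ⟨hH, hcov, hhom, hne, hcoc⟩ := hN
  choose a ha using hcov
  choose p q d hp hq hpx hqx hpq using fun (x : P2) (hx : x ∈ S) =>
    hreg x hx (a x hx) (ha x hx)
  choose G e hG hGx hGy using hsep
  refine ⟨⟨{x // x ∈ S}, fun x => G x x.2 * N.H (a x x.2) * p x x.2 * q x x.2,
    fun x => e x x.2 + N.Hdeg (a x x.2) + d x x.2 + d x x.2, fun x => a x x.2,
    fun x => p x x.2, fun x => q x x.2, fun x => d x x.2⟩, ⟨?_, ?_, ?_, ?_, ?_, ?_⟩, ?_⟩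
  · exact fun x => (((hG _ _).mul (hH _)).mul (hp _ _)).mul (hq _ _)
  · exact fun x hx => ⟨⟨x, hx⟩, by simp [hGx x hx, ha x hx, hpx x hx, hqx x hx]⟩
  · intro x y _ hy
    simp only [pev_mul, ne_eq, mul_eq_zero, not_or] at hy
    exact hy.1.1.2
  · exact fun x => ⟨hp _ _, hq _ _⟩
  · intro x y _ hy
    simp only [pev_mul, ne_eq, mul_eq_zero, not_or] at hy
    exact hy.2
  · intro x x' y hyS hy hy'
    simp only [pev_mul, ne_eq, mul_eq_zero, not_or] at hy hy'
    obtain ⟨⟨⟨g1, g2⟩, g3⟩, g4⟩ := hy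
    obtain ⟨⟨⟨g1', g2'⟩, g3'⟩, g4'⟩ := hy'
    by_cases hby : pev b y = 0
    · have e1 := hGy x x.2 y hyS hby g1
      have e2 := hGy x' x'.2 y hyS hby g1'
      have e3 : x = x' := Subtype.ext (e1.symm.trans e2)
      subst e3
      have h1 := hcoc (a x x.2) (a x x.2) (a x x.2) y hyS g2 g2 g2
      have h2 := hne (a x x.2) (a x x.2) y hyS g2 g2
      have : pev (N.num (a x x.2) (a x x.2)) y = pev (N.den (a x x.2) (a x x.2)) y := by
        apply mul_left_cancel₀ (mul_ne_zero h2.1 h2.2)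
        linear_combination h1
      change pev (N.num (a x x.2) (a x x.2)) y * _ * _ = pev (N.den (a x x.2) (a x x.2)) y * _ * _
      rw [this]
      ring
    · have h1 := ht (a x x.2) (a x' x'.2) y hyS hby g2 g2'
      rw [hpq _ _ y hyS hby g3 g4, hpq _ _ y hyS hby g3' g4', BundleData.gval] at h1
      have h2 := (hne (a x x.2) (a x' x'.2) y hyS g2 g2').2
      field_simp at h1
      linear_combination -h1
  · intro x y _ hy
    simp only [pev_mul, ne_eq, mul_eq_zero, not_or] at hy
    exact hy.1.2

lemma eval_add_of_isHomogeneous_one {g : MvPolynomial (Fin 3) ℂ} (hg : g.IsHomogeneous 1)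
    (v w : Fin 3 → ℂ) : eval (v + w) g = eval v g + eval w g :=
  (linearFunctional g hg).map_add v w

lemma eval_sub_of_isHomogeneous_one {g : MvPolynomial (Fin 3) ℂ} (hg : g.IsHomogeneous 1)
    (v w : Fin 3 → ℂ) : eval (v - w) g = eval v g - eval w g :=
  (linearFunctional g hg).map_sub v w

lemma eval_smul_of_isHomogeneous_one {g : MvPolynomial (Fin 3) ℂ} (hg : g.IsHomogeneous 1)
    (c : ℂ) (v : Fin 3 → ℂ) : eval (c • v) g = c * eval v g :=
  (linearFunctional g hg).map_smul c v

/-- The common zeros of two distinct lines. -/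
lemma exists_dual_vectors {l l' : MvPolynomial (Fin 3) ℂ} (hl : l.IsHomogeneous 1)
    (hl' : l'.IsHomogeneous 1) (hl0 : l ≠ 0) (hl0' : l' ≠ 0)
    (hne : zeroLocus l ≠ zeroLocus l') :
    ∃ f₁ f₂ r : Fin 3 → ℂ, eval f₁ l = 1 ∧ eval f₁ l' = 0 ∧ eval f₂ l = 0 ∧ eval f₂ l' = 1 ∧
      r ≠ 0 ∧ eval r l = 0 ∧ eval r l' = 0 ∧
      ∀ v, eval v l = 0 → eval v l' = 0 → ∃ a : ℂ, v = a • r := by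
  have hex : ∀ g : MvPolynomial (Fin 3) ℂ, g ≠ 0 → ∃ v, eval v g ≠ 0 := by
    intro g hg
    by_contra! h
    exact hg (MvPolynomial.funext fun v => by simpa using h v)
  have hhalf : ∀ g g' : MvPolynomial (Fin 3) ℂ, g.IsHomogeneous 1 → g'.IsHomogeneous 1 → g ≠ 0 →
      ∀ x, eval x g = 0 → eval x g' ≠ 0 → ∃ f₁ f₂ : Fin 3 → ℂ, eval f₁ g = 1 ∧ eval f₁ g' = 0 ∧
        eval f₂ g = 0 ∧ eval f₂ g' = 1 := by
    intro g g' hg hg' hg0 x hx hx'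
    obtain ⟨y, hy⟩ := hex g hg0
    refine ⟨(eval y g)⁻¹ • (y - (eval y g' / eval x g') • x), (eval x g')⁻¹ • x, ?_⟩
    simp only [eval_smul_of_isHomogeneous_one, eval_sub_of_isHomogeneous_one, hg, hg']
    refine ⟨?_, ?_, ?_, ?_⟩ <;> simp [hx, hx', hy]
  obtain ⟨f₁, f₂, h1, h2, h3, h4⟩ : ∃ f₁ f₂ : Fin 3 → ℂ, eval f₁ l = 1 ∧ eval f₁ l' = 0 ∧
      eval f₂ l = 0 ∧ eval f₂ l' = 1 := by
    by_cases hsub : ∀ x, pev l x = 0 → pev l' x = 0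
    · obtain ⟨x, hx', hx⟩ : ∃ x, pev l' x = 0 ∧ pev l x ≠ 0 := by
        by_contra! h
        exact hne (Set.ext fun x => ⟨hsub x, h x⟩)
      obtain ⟨f₁, f₂, h1, h2, h3, h4⟩ := hhalf l' l hl' hl hl0' x.rep hx' hx
      exact ⟨f₂, f₁, h4, h3, h2, h1⟩
    · push Not at hsub
      obtain ⟨x, hx, hx'⟩ := hsub
      exact hhalf l l' hl hl' hl0 x.rep hx hx'
  set φ : (Fin 3 → ℂ) →ₗ[ℂ] ℂ × ℂ := (linearFunctional l hl).prod (linearFunctional l' hl')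
    with hφ
  have hsurj : LinearMap.range φ = ⊤ := by
    rw [LinearMap.range_eq_top]
    rintro ⟨a, b⟩
    refine ⟨a • f₁ + b • f₂, ?_⟩
    simp [hφ, eval_add_of_isHomogeneous_one, eval_smul_of_isHomogeneous_one, hl, hl', h1, h2, h3, h4]
  have hrank : Module.finrank ℂ (LinearMap.ker φ) = 1 := by
    have := LinearMap.finrank_range_add_finrank_ker φ
    rw [hsurj, finrank_top] at this
    simp at this
    omega
  obtain ⟨⟨r, hr⟩, hr0, hspan⟩ := finrank_eq_one_iff'.mp hrank
  have hr' : eval r l = 0 ∧ eval r l' = 0 := by simpa [hφ] using hr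
  refine ⟨f₁, f₂, r, h1, h2, h3, h4, fun h => hr0 (Subtype.ext h), hr'.1, hr'.2, fun v h h' => ?_⟩
  obtain ⟨a, ha⟩ := hspan ⟨v, by simp [hφ, h, h']⟩
  exact ⟨a, (congrArg Subtype.val ha).symm⟩

lemma polar_ne_zero {F : MvPolynomial (Fin 3) ℂ} {v : Fin 3 → ℂ} {m : Fin 3}
    (h : eval v (pderiv m F) ≠ 0) : polar F v (Pi.single m 1) ≠ 0 := by
  simpa [polar, Pi.single_apply] using h

/-- Every smooth conic has no singular vector. -/
lemma exists_pderiv_ne_zero {F : MvPolynomial (Fin 3) ℂ} (hF : F.IsHomogeneous 2)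
    (hs : ∀ x : P2, pev F x = 0 → ∃ m : Fin 3, pev (pderiv m F) x ≠ 0) {v : Fin 3 → ℂ}
    (hv : v ≠ 0) (h : eval v F = 0) : ∃ m, eval v (pderiv m F) ≠ 0 := by
  obtain ⟨m, hm⟩ := hs (Projectivization.mk ℂ v hv) ((pev_mk_eq_zero hF hv).mpr h)
  exact ⟨m, fun h0 => hm ((pev_mk_eq_zero hF.pderiv hv).mpr h0)⟩

lemma IsTangentLineAt.exists_polar_eq {F l : MvPolynomial (Fin 3) ℂ} {P : P2}
    (hl : l.IsHomogeneous 1)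
    (hs : ∀ x : P2, pev F x = 0 → ∃ m : Fin 3, pev (pderiv m F) x ≠ 0)
    (h : IsTangentLineAt l F P) : ∃ c : ℂ, c ≠ 0 ∧ ∀ w, polar F P.rep w = c * eval w l := by
  obtain ⟨-, hF, c, hc⟩ := h
  refine ⟨c, ?_, fun w => ?_⟩
  · rintro rfl
    obtain ⟨m, hm⟩ := hs P hF
    exact hm (by rw [hc, zero_mul])
  · rw [eval_eq_sum_pderiv hl P.rep w, Finset.mul_sum, polar]
    exact Finset.sum_congr rfl fun m _ => by
      have := hc m
      rw [pev, pev] at this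
      rw [this, mul_assoc]

lemma exists_conicFrame {F l l' : MvPolynomial (Fin 3) ℂ} {P P' : P2} (hF : F.IsHomogeneous 2)
    (hs : ∀ x : P2, pev F x = 0 → ∃ m : Fin 3, pev (pderiv m F) x ≠ 0)
    (hl : l.IsHomogeneous 1) (hl' : l'.IsHomogeneous 1) (hl0 : l ≠ 0) (hl0' : l' ≠ 0)
    (hne : zeroLocus l ≠ zeroLocus l') (h : IsTangentLineAt l F P)
    (h' : IsTangentLineAt l' F P') : Nonempty (ConicFrame F l l') := by
  obtain ⟨f₁, f₂, r, l1, l1', l2, l2', hr0, hrl, hrl', hspan⟩ :=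
    exists_dual_vectors hl hl' hl0 hl0' hne
  obtain ⟨c, hc, hpol⟩ := h.exists_polar_eq hl hs
  obtain ⟨c', hc', hpol'⟩ := h'.exists_polar_eq hl' hs
  have hlp : eval P.rep l = 0 := h.1
  have hlq' : eval P'.rep l' = 0 := h'.1
  have hFp : eval P.rep F = 0 := h.2.1
  have hFq : eval P'.rep F = 0 := h'.2.1
  have hp0 := P.rep_nonzero
  have hq0 := P'.rep_nonzero
  generalize P.rep = p at *
  generalize P'.rep = q at *
  have hpq : c * eval q l = c' * eval p l' := by rw [← hpol, ← hpol', polar_comm hF]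
  have hlp' : eval p l' ≠ 0 := by
    intro h0
    have hlq : eval q l = 0 := by
      rw [h0, mul_zero] at hpq
      exact (mul_eq_zero.mp hpq).resolve_left hc
    obtain ⟨a, rfl⟩ := hspan p hlp h0
    obtain ⟨b, rfl⟩ := hspan q hlq hlq'
    have ha : a ≠ 0 := by rintro rfl; simp at hp0
    have e1 := hpol f₁
    have e2 := hpol' f₁
    rw [polar_smul_left hF, l1, mul_one] at e1
    rw [polar_smul_left hF, l1', mul_zero] at e2
    have hb : b ≠ 0 := by rintro rfl; simp at hq0
    rw [(mul_eq_zero.mp e2).resolve_left hb, mul_zero] at e1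
    exact hc e1.symm
  have hlq : eval q l ≠ 0 := by
    intro h0
    rw [h0, mul_zero] at hpq
    exact mul_ne_zero hc' hlp' hpq.symm
  have hrp : polar F p r = 0 := by rw [hpol, hrl, mul_zero]
  have hrq : polar F q r = 0 := by rw [hpol', hrl', mul_zero]
  have hdec : ∀ v, ∃ a : ℂ, v = (eval v l' / eval p l') • p + (eval v l / eval q l) • q + a • r := by
    intro v
    obtain ⟨a, ha⟩ := hspan (v - ((eval v l' / eval p l') • p + (eval v l / eval q l) • q))
      (by simp [eval_sub_of_isHomogeneous_one, eval_add_of_isHomogeneous_one,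
        eval_smul_of_isHomogeneous_one, hl, hlp, hlq])
      (by simp [eval_sub_of_isHomogeneous_one, eval_add_of_isHomogeneous_one,
        eval_smul_of_isHomogeneous_one, hl', hlp', hlq'])
    exact ⟨a, by rw [← ha]; abel⟩
  have hpolr : ∀ x y a : ℂ, polar F r (x • p + y • q + a • r) = a * (2 * eval r F) := by
    intro x y a
    rw [polar_add_right, polar_add_right, polar_smul_right, polar_smul_right, polar_smul_right,
      polar_comm hF r p, polar_comm hF r q, hrp, hrq, polar_self hF]
    ring
  have hFr : eval r F ≠ 0 := by
    intro h0
    obtain ⟨m, hm⟩ := exists_pderiv_ne_zero hF hs hr0 h0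
    apply polar_ne_zero hm
    obtain ⟨a, ha⟩ := hdec (Pi.single m 1)
    rw [ha, hpolr, h0]
    ring
  have hFv : ∀ x y a : ℂ, eval (x • p + y • q + a • r) F
      = x * y * (c * eval q l) + a ^ 2 * eval r F := by
    intro x y a
    have h2 : (2 : ℂ) ≠ 0 := two_ne_zero
    apply mul_left_cancel₀ h2
    rw [← polar_self hF]
    simp only [polar_add_right, polar_smul_right, polar_add_left hF, polar_smul_left hF]
    rw [polar_self hF, polar_self hF, polar_self hF, hFp, hFq, hrp, hrq, polar_comm hF r p,
      polar_comm hF r q, hrp, hrq, polar_comm hF q p, hpol]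
    ring
  obtain ⟨s, hs2⟩ := IsAlgClosed.exists_pow_nat_eq (-(eval r F) / (c / eval p l')) two_pos
  have hs0 : s ≠ 0 := by
    rintro rfl
    rw [zero_pow two_ne_zero] at hs2
    exact div_ne_zero (neg_ne_zero.mpr hFr) (div_ne_zero hc hlp') hs2.symm
  set M : MvPolynomial (Fin 3) ℂ :=
    C (s / (2 * eval r F)) * ∑ m, C (eval r (pderiv m F)) * X m with hM
  have hMev : ∀ v, eval v M = s / (2 * eval r F) * polar F r v := by
    intro v
    simp [hM, polar]
  have hMdec : ∀ x y a : ℂ, eval (x • p + y • q + a • r) M = s * a := by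
    intro x y a
    rw [hMev, hpolr]
    field_simp
  have hMhom : M.IsHomogeneous 1 :=
    (IsHomogeneous.sum _ _ _ fun m _ => isHomogeneous_C_mul_X _ m).C_mul _
  refine ⟨⟨M, c / eval p l', (eval q l)⁻¹ • q, (eval p l')⁻¹ • p, s⁻¹ • r, hl, hl', hMhom,
    div_ne_zero hc hlp', ?_, ?_, ?_, ?_, ?_, ?_, ?_, ?_, ?_, ?_, ?_⟩⟩
  · refine MvPolynomial.funext fun v => ?_
    obtain ⟨a, ha⟩ := hdec v
    have e1 : eval v F = _ := (congrArg (fun v => eval v F) ha).trans (hFv _ _ _)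
    have e2 : eval v M = _ := (congrArg (fun v => eval v M) ha).trans (hMdec _ _ _)
    simp only [map_mul, map_sub, map_pow, eval_C]
    rw [e1, e2, mul_pow, hs2]
    field_simp
    ring
  · rw [eval_smul_of_isHomogeneous hl]; simp [hlq]
  · rw [eval_smul_of_isHomogeneous hl]; simp [hlp]
  · rw [eval_smul_of_isHomogeneous hl]; simp [hrl]
  · rw [eval_smul_of_isHomogeneous hl']; simp [hlq']
  · rw [eval_smul_of_isHomogeneous hl']; simp [hlp']
  · rw [eval_smul_of_isHomogeneous hl']; simp [hrl']
  · have := hMdec 0 (eval q l)⁻¹ 0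
    simpa using this
  · have := hMdec (eval p l')⁻¹ 0 0
    simpa using this
  · have := hMdec 0 0 s⁻¹
    simpa [hs0] using this
  · intro v
    obtain ⟨a, ha⟩ := hdec v
    have e2 : eval v M = _ := (congrArg (fun v => eval v M) ha).trans (hMdec _ _ _)
    rw [e2, smul_smul, smul_smul, smul_smul, mul_right_comm, mul_inv_cancel₀ hs0, one_mul]
    conv_lhs => rw [ha]
    simp only [div_eq_mul_inv]
    abel

namespace ConicFrame

variable {F l l' : MvPolynomial (Fin 3) ℂ}

/-- Exchange the two tangent lines of a conic frame. -/
def symm (Φ : ConicFrame F l l') : ConicFrame F l' l where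
  M := Φ.M
  κ := Φ.κ
  e₁ := Φ.e₂
  e₂ := Φ.e₁
  e₃ := Φ.e₃
  hl := Φ.hl'
  hl' := Φ.hl
  hM := Φ.hM
  hκ := Φ.hκ
  eqn := by rw [mul_comm l' l]; exact Φ.eqn
  l_e₁ := Φ.l'_e₂
  l_e₂ := Φ.l'_e₁
  l_e₃ := Φ.l'_e₃
  l'_e₁ := Φ.l_e₂
  l'_e₂ := Φ.l_e₁
  l'_e₃ := Φ.l_e₃
  M_e₁ := Φ.M_e₂
  M_e₂ := Φ.M_e₁
  M_e₃ := Φ.M_e₃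
  span v := by rw [add_comm (eval v l' • Φ.e₂)]; exact Φ.span v

/-- Reverse the sign of the chord of contact of a conic frame. -/
def neg (Φ : ConicFrame F l l') : ConicFrame F l l' where
  M := -Φ.M
  κ := Φ.κ
  e₁ := Φ.e₁
  e₂ := Φ.e₂
  e₃ := -Φ.e₃
  hl := Φ.hl
  hl' := Φ.hl'
  hM := Φ.hM.neg
  hκ := Φ.hκ
  eqn := by rw [neg_sq]; exact Φ.eqn
  l_e₁ := Φ.l_e₁
  l_e₂ := Φ.l_e₂
  l_e₃ := by
    rw [← neg_one_smul ℂ, eval_smul_of_isHomogeneous_one Φ.hl, Φ.l_e₃, mul_zero]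
  l'_e₁ := Φ.l'_e₁
  l'_e₂ := Φ.l'_e₂
  l'_e₃ := by
    rw [← neg_one_smul ℂ, eval_smul_of_isHomogeneous_one Φ.hl', Φ.l'_e₃, mul_zero]
  M_e₁ := by simp [Φ.M_e₁]
  M_e₂ := by simp [Φ.M_e₂]
  M_e₃ := by
    rw [← neg_one_smul ℂ, eval_smul_of_isHomogeneous_one Φ.hM.neg, map_neg, Φ.M_e₃]
    ring
  span v := by simpa using Φ.span v

lemma pev_eq_zero_iff (Φ : ConicFrame F l l') (x : P2) :
    pev F x = 0 ↔ pev l x * pev l' x = pev Φ.M x ^ 2 :=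
  Φ.eval_eq_zero_iff _

lemma rep_eq (Φ : ConicFrame F l l') {x : P2} (hx : pev F x = 0) (hl : pev l x = 0) :
    pev l' x ≠ 0 ∧ pev Φ.M x = 0 ∧ x.rep = pev l' x • Φ.e₂ := by
  have hM : pev Φ.M x = 0 := by
    rw [Φ.pev_eq_zero_iff, hl, zero_mul] at hx
    simpa using hx.symm
  have h : x.rep = pev l' x • Φ.e₂ := by
    have := Φ.span x.rep
    rw [show eval x.rep l = 0 from hl, show eval x.rep Φ.M = 0 from hM] at this
    simpa [pev] using this
  refine ⟨fun h0 => x.rep_nonzero ?_, hM, h⟩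
  rw [h, h0, zero_smul]

/-- A tangent line meets the conic in a single point. -/
lemma eq_of_pev_eq_zero (Φ : ConicFrame F l l') {x y : P2} (hx : pev F x = 0) (hl : pev l x = 0)
    (hy : pev F y = 0) (hl' : pev l y = 0) : x = y := by
  obtain ⟨hx0, -, hx⟩ := Φ.rep_eq hx hl
  obtain ⟨hy0, -, hy⟩ := Φ.rep_eq hy hl'
  rw [← x.mk_rep, ← y.mk_rep, Projectivization.mk_eq_mk_iff']
  exact ⟨pev l' x / pev l' y, by rw [hy, smul_smul, div_mul_cancel₀ _ hy0, ← hx]⟩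

lemma pointIdeal_le (Φ : ConicFrame F l l') {x : P2} (hx : pev F x = 0) (hl : pev l x = 0) :
    pointIdeal x ≤ Ideal.span {l, Φ.M} := by
  obtain ⟨h0, -, hrep⟩ := Φ.rep_eq hx hl
  refine Ideal.span_le.mpr ?_
  rintro g ⟨hg, hgx⟩
  have hg2 : eval Φ.e₂ g = 0 := by
    rw [pev, hrep, eval_smul_of_isHomogeneous_one hg] at hgx
    exact (mul_eq_zero.mp hgx).resolve_left h0
  refine Ideal.mem_span_pair.mpr ⟨C (eval Φ.e₁ g), C (eval Φ.e₃ g), ?_⟩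
  refine MvPolynomial.funext fun v => ?_
  have := congrArg (fun w => eval w g) (Φ.span v)
  simp only [Φ.eval_comb hg, hg2] at this
  rw [this]
  simp
  ring

end ConicFrame

/-- A section of order one at the contact points of two tangent lines differs from the chord of
contact by a local unit of the conic. -/
lemma ConicFrame.exists_ratio_of_ordEq {f f' l l' : MvPolynomial (Fin 3) ℂ}
    (Φ : ConicFrame f l l') {n' : ℕ} (hf' : f'.IsHomogeneous n') {x : P2} (hx : pev f x = 0)
    {g : MvPolynomial (Fin 3) ℂ} {d : ℕ} (hg : g.IsHomogeneous d) (hx' : pev f' x ≠ 0)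
    (hl : pev l x = 0) (hord : OrdEq (f * f') x g 1) :
    ∃ (p w : MvPolynomial (Fin 3) ℂ) (m : ℕ), p.IsHomogeneous (m + 1) ∧ w.IsHomogeneous (m + d) ∧
      pev p x ≠ 0 ∧ pev w x ≠ 0 ∧ ∀ y, pev f y = 0 → pev (l * l') y ≠ 0 → pev w y ≠ 0 →
        pev g y ≠ 0 ∧ pev Φ.M y * pev w y = pev p y * pev g y := by
  obtain ⟨⟨Hl₀, e₀, hHl₀, hHlx₀, hmem₀⟩, hnot⟩ := hord
  obtain ⟨k, hk⟩ := exists_pev_X_ne_zero x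
  obtain ⟨Hl, e, hHl, hHlx, hmem, he⟩ : ∃ (Hl : MvPolynomial (Fin 3) ℂ) (e : ℕ),
      Hl.IsHomogeneous e ∧ pev Hl x ≠ 0 ∧
      Hl * g ∈ Ideal.span {f * f'} ⊔ pointIdeal x ^ 1 ∧ 2 ≤ e := by
    refine ⟨X k ^ 2 * Hl₀, 1 * 2 + e₀, ((isHomogeneous_X ℂ k).pow 2).mul hHl₀, by simp [hk, hHlx₀],
      ?_, by omega⟩
    rw [mul_assoc]
    exact Ideal.mul_mem_left _ _ hmem₀
  obtain ⟨hl'x, hMx, -⟩ := Φ.rep_eq hx hl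
  rw [pow_one] at hmem
  obtain ⟨u, hu, v, hv, huv⟩ := Submodule.mem_sup.mp
    ((sup_le_sup_left (Φ.pointIdeal_le hx hl) _ : _ ≤ _) hmem)
  obtain ⟨α, rfl⟩ := Ideal.mem_span_singleton'.mp hu
  obtain ⟨β, γ, rfl⟩ := Ideal.mem_span_pair.mp hv
  set n := e + d with hn
  have hcomp := congrArg (homogeneousComponent n) huv
  rw [homogeneousComponent_of_mem (hHl.mul hg), if_pos rfl, map_add, map_add,
    show α * (f * f') = f * (f' * α) by ring, mul_comm β, mul_comm γ,
    homogeneousComponent_mul_left Φ.isHomogeneous (by omega),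
    homogeneousComponent_mul_left Φ.hl (by omega),
    homogeneousComponent_mul_left Φ.hM (by omega)] at hcomp
  set a := homogeneousComponent (n - 2) (f' * α)
  have hb : (homogeneousComponent (n - 1) β).IsHomogeneous (n - 1) :=
    homogeneousComponent_isHomogeneous _ _
  have hc : (homogeneousComponent (n - 1) γ).IsHomogeneous (n - 1) :=
    homogeneousComponent_isHomogeneous _ _
  set b := homogeneousComponent (n - 1) β
  set c := homogeneousComponent (n - 1) γ
  have hcx : pev c x ≠ 0 := by
    intro hc0
    apply hnot
    refine ⟨l' * f' * Hl, 1 + n' + e, (Φ.hl'.mul hf').mul hHl, by simp [hl'x, hx', hHlx], ?_⟩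
    have hMI : Φ.M ∈ pointIdeal x := mem_pointIdeal Φ.hM hMx
    have hcI : c ∈ pointIdeal x := mem_pointIdeal hc hc0
    have h1 : l * l' = C (Φ.κ)⁻¹ * f + Φ.M ^ 2 := by
      have : C (Φ.κ)⁻¹ * f = l * l' - Φ.M ^ 2 := by
        have h := congrArg (C (Φ.κ)⁻¹ * ·) Φ.eqn
        refine h.trans ?_
        rw [← mul_assoc, ← C_mul, inv_mul_cancel₀ Φ.hκ, C_1, one_mul]
      rw [this]
      ring
    have h2 : l' * f' * Hl * g = (a * l' + C (Φ.κ)⁻¹ * b) * (f * f')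
        + ((f' * b) * (Φ.M * Φ.M) + (l' * f') * (Φ.M * c)) := by
      linear_combination (-l' * f') * hcomp + f' * b * h1
    rw [h2, pow_two]
    refine Submodule.add_mem_sup (Ideal.mul_mem_left _ _ (Ideal.mem_span_singleton_self _)) ?_
    exact Ideal.add_mem _ (Ideal.mul_mem_left _ _ (Ideal.mul_mem_mul hMI hMI))
      (Ideal.mul_mem_left _ _ (Ideal.mul_mem_mul hMI hcI))
  have hw : (Φ.M * b + l' * c).IsHomogeneous n := by
    have h1 := Φ.hM.mul hb
    have h2 := Φ.hl'.mul hc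
    rw [show 1 + (n - 1) = n by omega] at h1 h2
    exact h1.add h2
  refine ⟨l' * Hl, Φ.M * b + l' * c, e, ?_, hw, by simp [hl'x, hHlx], by simp [hMx, hl'x, hcx], ?_⟩
  · rw [add_comm]
    exact Φ.hl'.mul hHl
  · intro y hy hly hwy
    have h1 := congrArg (fun q => pev q y) hcomp
    have h2 := (Φ.pev_eq_zero_iff y).mp hy
    simp only [pev_mul, pev_add, hy] at h1
    have h3 : pev Φ.M y * pev (Φ.M * b + l' * c) y = pev (l' * Hl) y * pev g y := by
      simp only [pev_mul, pev_add]
      linear_combination pev l' y * h1 - pev b y * h2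
    refine ⟨fun h0 => ?_, h3⟩
    rw [h0, mul_zero] at h3
    have hM0 := (mul_eq_zero.mp h3).resolve_right hwy
    rw [hM0] at h2
    apply hly
    rw [pev_mul, h2]
    ring

lemma pev_ne_zero_of_ordEq_zero {f g : MvPolynomial (Fin 3) ℂ} {d : ℕ} {x : P2}
    (hg : g.IsHomogeneous d) (h : OrdEq f x g 0) : pev g x ≠ 0 := by
  intro h0
  apply h.2
  refine ⟨1, 0, isHomogeneous_one _ _, by simp, ?_⟩
  rw [one_mul, zero_add, pow_one]
  exact Ideal.mem_sup_right (mem_pointIdeal hg h0)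

namespace UnitRegAt

variable {S : Set P2} {b : MvPolynomial (Fin 3) ℂ} {g : P2 → ℂ} {x : P2}

lemma of_one (h : UnitRegAt S 1 g x) (b : MvPolynomial (Fin 3) ℂ) : UnitRegAt S b g x := by
  obtain ⟨p, q, d, hp, hq, hpx, hqx, hg⟩ := h
  exact ⟨p, q, d, hp, hq, hpx, hqx, fun y hy _ h1 h2 => hg y hy (by simp) h1 h2⟩

lemma mono {b' : MvPolynomial (Fin 3) ℂ} (h : UnitRegAt S b g x)
    (hb : ∀ y, pev b' y ≠ 0 → pev b y ≠ 0) : UnitRegAt S b' g x := by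
  obtain ⟨p, q, d, hp, hq, hpx, hqx, hg⟩ := h
  exact ⟨p, q, d, hp, hq, hpx, hqx, fun y hy h0 h1 h2 => hg y hy (hb y h0) h1 h2⟩

lemma ne_zero (h : UnitRegAt S b g x) (hx : x ∈ S) (hb : pev b x ≠ 0) : g x ≠ 0 := by
  obtain ⟨p, q, d, hp, hq, hpx, hqx, hg⟩ := h
  rw [hg x hx hb hpx hqx]
  exact div_ne_zero hpx hqx

end UnitRegAt

namespace BundleData

variable {S : Set P2} {L : BundleData S}

lemma Valid.gval_ne_zero (hL : L.Valid) {a b : L.ι} {y : P2} (hy : y ∈ S)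
    (ha : pev (L.H a) y ≠ 0) (hb : pev (L.H b) y ≠ 0) : L.gval a b y ≠ 0 :=
  have h := hL.2.2.2.1 a b y hy ha hb
  div_ne_zero h.1 h.2

lemma Valid.gval_mul (hL : L.Valid) {a b c : L.ι} {y : P2} (hy : y ∈ S)
    (ha : pev (L.H a) y ≠ 0) (hb : pev (L.H b) y ≠ 0) (hc : pev (L.H c) y ≠ 0) :
    L.gval a b y * L.gval b c y = L.gval a c y := by
  have h := hL.2.2.2.2 a b c y hy ha hb hc
  have h1 := (hL.2.2.2.1 a b y hy ha hb).2
  have h2 := (hL.2.2.2.1 b c y hy hb hc).2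
  have h3 := (hL.2.2.2.1 a c y hy ha hc).2
  rw [gval, gval, gval, div_mul_div_comm, div_eq_div_iff (mul_ne_zero h1 h2) h3]
  linear_combination h

lemma Valid.unitRegAt_gval (hL : L.Valid) {a b : L.ι} {x : P2} (hx : x ∈ S)
    (ha : pev (L.H a) x ≠ 0) (hb : pev (L.H b) x ≠ 0) : UnitRegAt S 1 (L.gval a b) x :=
  have h := hL.2.2.2.1 a b x hx ha hb
  ⟨_, _, _, (hL.2.2.1 a b).1, (hL.2.2.1 a b).2, h.1, h.2, fun _ _ _ _ _ => rfl⟩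

lemma Valid.tensor {M : BundleData S} (hL : L.Valid) (hM : M.Valid) : (L.tensor M).Valid := by
  refine ⟨fun a => (hL.1 _).mul (hM.1 _), fun x hx => ?_,
    fun a b => ⟨(hL.2.2.1 _ _).1.mul (hM.2.2.1 _ _).1, (hL.2.2.1 _ _).2.mul (hM.2.2.1 _ _).2⟩,
    fun a b x hx ha hb => ?_, fun a b c x hx ha hb hc => ?_⟩
  · obtain ⟨a, ha⟩ := hL.2.1 x hx
    obtain ⟨b, hb⟩ := hM.2.1 x hx
    exact ⟨(a, b), by simp [BundleData.tensor, ha, hb]⟩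
  · simp only [BundleData.tensor, pev_mul, ne_eq, mul_eq_zero, not_or] at ha hb ⊢
    exact ⟨⟨(hL.2.2.2.1 _ _ x hx ha.1 hb.1).1, (hM.2.2.2.1 _ _ x hx ha.2 hb.2).1⟩,
      ⟨(hL.2.2.2.1 _ _ x hx ha.1 hb.1).2, (hM.2.2.2.1 _ _ x hx ha.2 hb.2).2⟩⟩
  · simp only [BundleData.tensor, pev_mul, ne_eq, mul_eq_zero, not_or] at ha hb hc ⊢
    have h1 := hL.2.2.2.2 _ _ _ x hx ha.1 hb.1 hc.1
    have h2 := hM.2.2.2.2 _ _ _ x hx ha.2 hb.2 hc.2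
    calc _ = (pev (L.num a.1 b.1) x * pev (L.num b.1 c.1) x * pev (L.den a.1 c.1) x) *
          (pev (M.num a.2 b.2) x * pev (M.num b.2 c.2) x * pev (M.den a.2 c.2) x) := by ring
      _ = _ := by rw [h1, h2]; ring

lemma Valid.dual (hL : L.Valid) : L.dual.Valid := by
  refine ⟨hL.1, hL.2.1, fun a b => (hL.2.2.1 a b).symm,
    fun a b x hx ha hb => (hL.2.2.2.1 a b x hx ha hb).symm, fun a b c x hx ha hb hc => ?_⟩
  have := hL.2.2.2.2 a b c x hx ha hb hc
  simp only [BundleData.dual]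
  linear_combination -this

lemma Valid.restrict (hL : L.Valid) {S' : Set P2} (h : S' ⊆ S) : (L.restrict S').Valid :=
  ⟨hL.1, fun x hx => hL.2.1 x (h hx), hL.2.2.1, fun a b x hx => hL.2.2.2.1 a b x (h hx),
    fun a b c x hx => hL.2.2.2.2 a b c x (h hx)⟩

end BundleData

lemma trivBundle_valid (S : Set P2) : (trivBundle S).Valid := by
  refine ⟨fun _ => isHomogeneous_one _ _, fun x _ => ⟨(), by simp [trivBundle]⟩,
    fun _ _ => ⟨isHomogeneous_one _ _, isHomogeneous_one _ _⟩, fun _ _ x _ _ _ => ?_,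
    fun _ _ _ x _ _ _ _ => ?_⟩ <;> simp [trivBundle]

lemma OdC_valid (S : Set P2) : (OdC S 1).Valid := by
  refine ⟨fun a => isHomogeneous_X _ _, fun x _ => exists_pev_X_ne_zero x,
    fun a b => ⟨?_, ?_⟩, fun a b x _ ha hb => ?_, fun a b c x _ ha hb hc => ?_⟩
  · simpa [OdC] using isHomogeneous_X ℂ b
  · simpa [OdC] using isHomogeneous_X ℂ a
  · simp only [OdC, pow_one] at *
    exact ⟨hb, ha⟩
  · simp only [OdC, pow_one]
    ring

namespace TrivData

variable {S : Set P2} {L : BundleData S}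

open Classical in
/-- The value at `y` of the section `T` read in the chart `a`. -/
def val (T : TrivData L) (a : L.ι) (y : P2) : ℂ :=
  if h : ∃ c, pev (T.K c) y ≠ 0 then L.gval a (T.toChart h.choose) y * T.lval h.choose y else 0

lemma ValidSection.val_eq {T : TrivData L} (hT : T.ValidSection) (hL : L.Valid) {a : L.ι}
    {c : T.σ} {y : P2} (hy : y ∈ S) (ha : pev (L.H a) y ≠ 0) (hc : pev (T.K c) y ≠ 0) :
    T.val a y = L.gval a (T.toChart c) y * T.lval c y := by
  have h : ∃ c, pev (T.K c) y ≠ 0 := ⟨c, hc⟩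
  rw [val, dif_pos h]
  have hc' := h.choose_spec
  generalize h.choose = c' at *
  have h1 := hT.2.2.1 c y hy hc
  have h2 := hT.2.2.1 c' y hy hc'
  have h3 : T.lval c y = L.gval (T.toChart c) (T.toChart c') y * T.lval c' y := by
    have h4 := hT.2.2.2.2.2 c c' y hy hc hc'
    have h5 := (hL.2.2.2.1 (T.toChart c) (T.toChart c') y hy h1 h2).2
    have h6 := hT.2.2.2.2.1 c y hy hc
    have h7 := hT.2.2.2.2.1 c' y hy hc'
    rw [lval, lval, BundleData.gval, div_mul_div_comm, div_eq_div_iff h6 (mul_ne_zero h5 h7)]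
    linear_combination -h4
  rw [h3, ← mul_assoc, hL.gval_mul hy ha h1 h2]

lemma ValidSection.val_eq_gval_mul {T : TrivData L} (hT : T.ValidSection) (hL : L.Valid)
    {a b : L.ι} {y : P2} (hy : y ∈ S) (ha : pev (L.H a) y ≠ 0) (hb : pev (L.H b) y ≠ 0) :
    T.val a y = L.gval a b y * T.val b y := by
  obtain ⟨c, hc⟩ := hT.2.1 y hy
  rw [hT.val_eq hL hy ha hc, hT.val_eq hL hy hb hc, ← mul_assoc,
    hL.gval_mul hy ha hb (hT.2.2.1 c y hy hc)]

lemma Valid.unitRegAt_val {T : TrivData L} (hT : T.Valid) (hL : L.Valid) {a : L.ι} {x : P2}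
    (hx : x ∈ S) (ha : pev (L.H a) x ≠ 0) : UnitRegAt S 1 (T.val a) x := by
  obtain ⟨c, hc⟩ := hT.1.2.1 x hx
  have hac := hT.1.2.2.1 c x hx hc
  have h1 : UnitRegAt S 1 (T.lval c) x :=
    ⟨_, _, _, (hT.1.2.2.2.1 c).1, (hT.1.2.2.2.1 c).2, hT.2 c x hx hc, hT.1.2.2.2.2.1 c x hx hc,
      fun _ _ _ _ _ => rfl⟩
  refine ((hL.unitRegAt_gval hx ha hac).mul h1).congr ((hT.1.1 c).mul (hL.1 a))
    (by simp [hc, ha]) fun y hy _ hK => ?_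
  simp only [pev_mul, ne_eq, mul_eq_zero, not_or] at hK
  exact hT.1.val_eq hL hy hK.2 hK.1

end TrivData

/-- A family of functions, one for each chart, representing a nowhere vanishing section of `L`
over a subset `S` of the curve. -/
structure IsUnitSection {S₀ : Set P2} (L : BundleData S₀) (S : Set P2) (t : L.ι → P2 → ℂ) :
    Prop where
  change : ∀ a b, ∀ y ∈ S, pev (L.H a) y ≠ 0 → pev (L.H b) y ≠ 0 → t a y = L.gval a b y * t b y
  reg : ∀ x ∈ S, ∀ a, pev (L.H a) x ≠ 0 → UnitRegAt S 1 (t a) x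

lemma IsUnitSection.of_restrict {S₀ S : Set P2} {L : BundleData S₀} (hL : L.Valid) (h : S ⊆ S₀)
    {T : TrivData (L.restrict S)} (hT : T.Valid) : IsUnitSection L S T.val where
  change _ _ _ hy ha hb := hT.1.val_eq_gval_mul (hL.restrict h) hy ha hb
  reg _ hx _ ha := hT.unitRegAt_val (hL.restrict h) hx ha

lemma UnitRegAt.subset {S S' : Set P2} {b : MvPolynomial (Fin 3) ℂ} {g : P2 → ℂ} {x : P2}
    (h : UnitRegAt S b g x) (hS : S' ⊆ S) : UnitRegAt S' b g x :=
  h.congr_of_subset (isHomogeneous_one _ _) (by simp) fun _ hy _ _ => ⟨hS hy, rfl⟩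

section Coval

variable {S : Set P2} {L : BundleData S}

/-- The chart of `L` underlying a refined chart of a section of `L^∨ ⊗ 𝒪(1)`. -/
def chartL (s : TrivData (L.dual.tensor (OdC S 1))) (c : s.σ) : L.ι := (s.toChart c).1

/-- The coordinate chart underlying a refined chart of a section of `L^∨ ⊗ 𝒪(1)`. -/
def chartX (s : TrivData (L.dual.tensor (OdC S 1))) (c : s.σ) : Fin 3 := (s.toChart c).2

lemma gval_dual_tensor_OdC (p q : L.ι × Fin 3) (y : P2) :
    (L.dual.tensor (OdC S 1)).gval p q y
      = (L.gval p.1 q.1 y)⁻¹ * (pev (X q.2) y / pev (X p.2) y) := by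
  change pev (L.den p.1 q.1 * X q.2 ^ 1) y / pev (L.num p.1 q.1 * X p.2 ^ 1) y = _
  rw [pev_mul, pev_mul, pow_one, pow_one, BundleData.gval, inv_div, div_mul_div_comm]

lemma pev_H_dual_tensor_OdC (p : L.ι × Fin 3) (y : P2) :
    pev ((L.dual.tensor (OdC S 1)).H p) y = pev (L.H p.1) y * pev (X p.2) y :=
  pev_mul _ _ _

/-- The value at `y` of a section of `L^∨ ⊗ 𝒪(1)`, read in the chart `a` of `L` and in homogeneous
coordinates. -/
def coval (s : TrivData (L.dual.tensor (OdC S 1))) (a : L.ι) (y : P2) : ℂ :=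
  pev (X (exists_pev_X_ne_zero y).choose) y * s.val (a, (exists_pev_X_ne_zero y).choose) y

variable {s : TrivData (L.dual.tensor (OdC S 1))}

lemma H_toChart_ne_zero (hs : s.ValidSection) {c : s.σ} {y : P2} (hy : y ∈ S)
    (hc : pev (s.K c) y ≠ 0) :
    pev (L.H (chartL s c)) y ≠ 0 ∧ pev (X (chartX s c)) y ≠ 0 := by
  have := hs.2.2.1 c y hy hc
  exact mul_ne_zero_iff.mp ((pev_H_dual_tensor_OdC (s.toChart c) y).symm.trans_ne this)

lemma coval_eq (hL : L.Valid) (hs : s.ValidSection) {a : L.ι} {c : s.σ} {y : P2} (hy : y ∈ S)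
    (ha : pev (L.H a) y ≠ 0) (hc : pev (s.K c) y ≠ 0) :
    coval s a y = (L.gval a (chartL s c) y)⁻¹ * pev (X (chartX s c)) y * s.lval c y := by
  have he := (exists_pev_X_ne_zero y).choose_spec
  rw [coval]
  generalize (exists_pev_X_ne_zero y).choose = e at *
  have hN := hL.dual.tensor (OdC_valid S)
  have h := hs.val_eq hN hy (a := (a, e)) (c := c)
    ((pev_H_dual_tensor_OdC (a, e) y).trans_ne (mul_ne_zero ha he)) hc
  have hg := gval_dual_tensor_OdC (S := S) (L := L) (a, e) (chartL s c, chartX s c) y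
  refine (congrArg (pev (X e) y * ·) (h.trans (congrArg (· * s.lval c y) hg))).trans ?_
  field_simp

lemma coval_change (hL : L.Valid) (hs : s.ValidSection) {a b : L.ι} {y : P2} (hy : y ∈ S)
    (ha : pev (L.H a) y ≠ 0) (hb : pev (L.H b) y ≠ 0) :
    L.gval a b y * coval s a y = coval s b y := by
  obtain ⟨c, hc⟩ := hs.2.1 y hy
  have hc' := (H_toChart_ne_zero hs hy hc).1
  rw [coval_eq hL hs hy ha hc, coval_eq hL hs hy hb hc, ← hL.gval_mul hy ha hb hc', mul_inv]
  have := hL.gval_ne_zero hy ha hb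
  field_simp

lemma coval_ne_zero (hL : L.Valid) (hs : s.ValidSection) {f : MvPolynomial (Fin 3) ℂ}
    {D : P2 →₀ ℕ} (hD : DivisorOfSectionEq S f s D) {a : L.ι} {y : P2} (hy : y ∈ S)
    (ha : pev (L.H a) y ≠ 0) (h0 : D y = 0) : coval s a y ≠ 0 := by
  obtain ⟨c, hc⟩ := hs.2.1 y hy
  have hc' := H_toChart_ne_zero hs hy hc
  have hord := hD.2 y hy c hc
  rw [h0] at hord
  rw [coval_eq hL hs hy ha hc]
  refine mul_ne_zero (mul_ne_zero (inv_ne_zero (hL.gval_ne_zero hy ha hc'.1)) hc'.2) ?_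
  exact div_ne_zero (pev_ne_zero_of_ordEq_zero (hs.2.2.2.1 c).1 hord) (hs.2.2.2.2.1 c y hy hc)

/-- The chord of contact generates the divisor of the tangency points along the conic. -/
lemma ConicFrame.unitRegAt_div_coval {f f' l l' : MvPolynomial (Fin 3) ℂ} (Φ : ConicFrame f l l')
    {n' : ℕ} (hf' : f'.IsHomogeneous n') (hL : L.Valid) (hs : s.ValidSection) {D : P2 →₀ ℕ}
    (hD : DivisorOfSectionEq S (f * f') s D) (hS : zeroLocus f ⊆ S)
    (hD0 : ∀ x ∈ zeroLocus f, pev (l * l') x ≠ 0 → D x = 0)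
    (hD1 : ∀ x ∈ zeroLocus f, pev (l * l') x = 0 → D x = 1 ∧ pev f' x ≠ 0)
    {x : P2} (hx : x ∈ zeroLocus f) {a : L.ι} (ha : pev (L.H a) x ≠ 0) :
    UnitRegAt (zeroLocus f) (l * l') (fun y => pev Φ.M y / coval s a y) x := by
  obtain ⟨c, hc⟩ := hs.2.1 x (hS hx)
  have hc' := H_toChart_ne_zero hs (hS hx) hc
  have hord := hD.2 x (hS hx) c hc
  have hnum := hL.2.2.2.1 a (chartL s c) x (hS hx) ha hc'.1
  have hhom := hL.2.2.1 a (chartL s c)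
  have hlden := hs.2.2.2.2.1 c x (hS hx) hc
  have hlhom := hs.2.2.2.1 c
  obtain ⟨p, w, m, hp, hw, hpx, hwx, hpw⟩ : ∃ (p w : MvPolynomial (Fin 3) ℂ) (m : ℕ),
      p.IsHomogeneous (m + 1) ∧ w.IsHomogeneous (m + s.ldeg c) ∧ pev p x ≠ 0 ∧ pev w x ≠ 0 ∧
      ∀ y, pev f y = 0 → pev (l * l') y ≠ 0 → pev w y ≠ 0 →
        pev (s.lnum c) y ≠ 0 ∧ pev Φ.M y * pev w y = pev p y * pev (s.lnum c) y := by
    by_cases h0 : pev (l * l') x = 0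
    · obtain ⟨hd1, hfx⟩ := hD1 x hx h0
      rw [hd1] at hord
      rw [pev_mul, mul_eq_zero] at h0
      rcases h0 with h0 | h0
      · exact Φ.exists_ratio_of_ordEq hf' hx hlhom.1 hfx h0 hord
      · rw [mul_comm l l']
        exact Φ.symm.exists_ratio_of_ordEq hf' hx hlhom.1 hfx h0 hord
    · rw [hD0 x hx h0] at hord
      refine ⟨Φ.M, s.lnum c, 0, by simpa using Φ.hM, by simpa using hlhom.1, fun hM => h0 ?_,
        pev_ne_zero_of_ordEq_zero hlhom.1 hord, fun y _ _ hy => ⟨hy, rfl⟩⟩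
      rw [pev_mul, (Φ.pev_eq_zero_iff x).mp hx, hM]
      ring
  refine UnitRegAt.of_ratio (p := p * L.num a (chartL s c) * s.lden c)
    (q := w * L.den a (chartL s c) * X (chartX s c)) (K := s.K c * L.H a)
    ((hp.mul hhom.1).mul hlhom.2) (e := s.Kdeg c + L.Hdeg a) ?_ ((hs.1 c).mul (hL.1 a))
    (by simp [hpx, hnum.1, hlden]) (by simp only [pev_mul]; simp [hwx, hnum.2, hc'.2])
    (by simp [hc, ha]) ?_
  · convert (hw.mul hhom.2).mul (isHomogeneous_X ℂ (chartX s c)) using 1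
    omega
  · intro y hy hb hpy hqy hK
    simp only [pev_mul, ne_eq, mul_eq_zero, not_or] at hpy hqy hK
    obtain ⟨h1, h2⟩ := hpw y hy (by simpa using hb) hqy.1.1
    rw [coval_eq hL hs (hS hy) hK.2 hK.1, BundleData.gval, TrivData.lval]
    simp only [pev_mul]
    have := hpy.1.2
    have := hpy.2
    have := hqy.1.1
    have := hqy.1.2
    have := hqy.2
    field_simp
    linear_combination h2

end Coval

/-- Two smooth conics meeting transversely, together with four distinct common tangent lines. -/
structure IsBitangentConfig (A : ConicLineArrangement 2) (l : Fin 4 → MvPolynomial (Fin 3) ℂ)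
    (Pt : Fin 4 → Fin 2 → P2) : Prop where
  deg : ∀ i, A.deg i = 2
  hom : ∀ i, (l i).IsHomogeneous 1
  ne_zero : ∀ i, l i ≠ 0
  dist : ∀ i j, i ≠ j → zeroLocus (l i) ≠ zeroLocus (l j)
  tan : ∀ i kk, IsTangentLineAt (l i) (A.f kk) (Pt i kk)

lemma ConicLineArrangement.curve_subset_plane {k : ℕ} (A : ConicLineArrangement k) (i : Fin k) :
    zeroLocus (A.f i) ⊆ A.plane :=
  Set.subset_iUnion A.curve i

lemma polar_single (F : MvPolynomial (Fin 3) ℂ) (v : Fin 3 → ℂ) (m : Fin 3) :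
    polar F v (Pi.single m 1) = eval v (pderiv m F) := by
  simp [polar, Pi.single_apply]

namespace IsBitangentConfig

variable {A : ConicLineArrangement 2} {l : Fin 4 → MvPolynomial (Fin 3) ℂ}
  {Pt : Fin 4 → Fin 2 → P2}

lemma mul_f_eq (A : ConicLineArrangement 2) {k k' : Fin 2} (hk : k ≠ k') :
    A.f 0 * A.f 1 = A.f k * A.f k' := by
  fin_cases k <;> fin_cases k' <;> simp_all [mul_comm]

lemma mem_plane {k k' : Fin 2} (hk : k ≠ k') {y : P2} (hy : y ∈ A.plane) :
    y ∈ zeroLocus (A.f k) ∨ y ∈ zeroLocus (A.f k') := by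
  obtain ⟨m, hm⟩ := Set.mem_iUnion.mp hy
  have : m = k ∨ m = k' := by omega
  rcases this with rfl | rfl
  · exact Or.inl hm
  · exact Or.inr hm

lemma f_hom (h : IsBitangentConfig A l Pt) (k : Fin 2) : (A.f k).IsHomogeneous 2 := by
  simpa [h.deg k] using A.homog k

/-- The frame of a conic attached to two of the bitangents. -/
def frame (h : IsBitangentConfig A l Pt) {i j : Fin 4} (hij : i ≠ j) (k : Fin 2) : ConicFrame (A.f k) (l i) (l j) :=
  (exists_conicFrame (h.f_hom k) (A.smooth k) (h.hom i) (h.hom j) (h.ne_zero i) (h.ne_zero j)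
    (h.dist i j hij) (h.tan i k) (h.tan j k)).some

lemma eq_Pt (h : IsBitangentConfig A l Pt) {i : Fin 4} {k : Fin 2} {x : P2} (hx : pev (A.f k) x = 0) (hl : pev (l i) x = 0) :
    x = Pt i k := by
  obtain ⟨j, hj⟩ := exists_ne i
  exact (h.frame hj.symm k).eq_of_pev_eq_zero hx hl (h.tan i k).2.1 (h.tan i k).1

lemma exists_polar_eq (h : IsBitangentConfig A l Pt) (i : Fin 4) (k : Fin 2) :
    ∃ c : ℂ, c ≠ 0 ∧ ∀ w, polar (A.f k) (Pt i k).rep w = c * eval w (l i) :=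
  (h.tan i k).exists_polar_eq (h.hom i) (A.smooth k)

lemma line_ne_zero (h : IsBitangentConfig A l Pt) {i : Fin 4} {k k' : Fin 2} (hk : k ≠ k') {x : P2} (hx : pev (A.f k) x = 0)
    (hx' : pev (A.f k') x = 0) : pev (l i) x ≠ 0 := by
  intro hl
  obtain ⟨c, hc, hp⟩ := h.exists_polar_eq i k
  obtain ⟨c', hc', hp'⟩ := h.exists_polar_eq i k'
  rw [← h.eq_Pt hx hl] at hp
  rw [← h.eq_Pt hx' hl] at hp'
  refine (A.nodes k k' hk x ⟨hx, hx'⟩).2 ⟨c' / c, fun m => ?_⟩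
  rw [pev, pev, ← polar_single, ← polar_single, hp, hp']
  field_simp

lemma line_Pt_ne_zero (h : IsBitangentConfig A l Pt) {i j : Fin 4} (hij : i ≠ j) (k : Fin 2) : pev (l i) (Pt j k) ≠ 0 := by
  intro hl
  have he := h.eq_Pt (h.tan j k).2.1 hl
  obtain ⟨c, hc, hp⟩ := h.exists_polar_eq i k
  obtain ⟨c', hc', hp'⟩ := h.exists_polar_eq j k
  rw [← he] at hp
  apply h.dist i j hij
  ext y
  have := (hp y.rep).symm.trans (hp' y.rep)
  constructor
  · intro hy
    have hy : eval y.rep (l i) = 0 := hy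
    rw [hy, mul_zero, eq_comm, mul_eq_zero] at this
    exact this.resolve_left hc'
  · intro hy
    have hy : eval y.rep (l j) = 0 := hy
    rw [hy, mul_zero, mul_eq_zero] at this
    exact this.resolve_left hc

lemma divisor_eq_zero (h : IsBitangentConfig A l Pt) {i j : Fin 4} {D : P2 →₀ ℕ} (hD : IsTangencyDivisor Pt i j D) {x : P2}
    (hx : pev (l i * l j) x ≠ 0) : D x = 0 := by
  rw [pev_mul, mul_ne_zero_iff] at hx
  have hne : ∀ m, x ≠ Pt i m ∧ x ≠ Pt j m := fun m =>
    ⟨fun e => hx.1 (e ▸ (h.tan i m).1), fun e => hx.2 (e ▸ (h.tan j m).1)⟩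
  simp [hD x, hne]

lemma Pt_ne (h : IsBitangentConfig A l Pt) {i : Fin 4} {k k' : Fin 2} (hk : k ≠ k') : Pt i k ≠ Pt i k' := fun e =>
  h.line_ne_zero hk (h.tan i k).2.1 (e ▸ (h.tan i k').2.1) (h.tan i k).1

lemma Pt_ne' (h : IsBitangentConfig A l Pt) {i j : Fin 4} (hij : i ≠ j) (k k' : Fin 2) : Pt i k ≠ Pt j k' := fun e =>
  h.line_Pt_ne_zero hij k' (e ▸ (h.tan i k).1)

lemma divisor_eq_one (h : IsBitangentConfig A l Pt) {i j : Fin 4} (hij : i ≠ j) {D : P2 →₀ ℕ} (hD : IsTangencyDivisor Pt i j D)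
    {k k' : Fin 2} (hk : k ≠ k') {x : P2} (hx : x ∈ zeroLocus (A.f k))
    (h0 : pev (l i * l j) x = 0) : D x = 1 ∧ pev (A.f k') x ≠ 0 := by
  rw [pev_mul, mul_eq_zero] at h0
  have h01 : (0 : Fin 2) ≠ 1 := by decide
  refine ⟨?_, fun hx' => ?_⟩
  · have hkk : k = 0 ∨ k = 1 := by omega
    rcases h0 with h0 | h0 <;> obtain rfl := h.eq_Pt hx h0 <;> rcases hkk with rfl | rfl <;>
      refine (hD _).trans ?_ <;> simp [h.Pt_ne h01, h.Pt_ne h01.symm, h.Pt_ne' hij, h.Pt_ne' hij.symm]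
  · rcases h0 with h0 | h0 <;> exact h.line_ne_zero hk hx hx' h0

end IsBitangentConfig

lemma IsTangencyDivisor.symm {Pt : Fin 4 → Fin 2 → P2} {i j : Fin 4} {D : P2 →₀ ℕ}
    (hD : IsTangencyDivisor Pt i j D) : IsTangencyDivisor Pt j i D := fun P => by
  rw [hD P]
  ring

lemma unitRegAt_div_coval_of_eq_zero {S : Set P2} {L : BundleData S}
    {s : TrivData (L.dual.tensor (OdC S 1))} (hL : L.Valid) (hs : s.ValidSection)
    {f m b : MvPolynomial (Fin 3) ℂ} {D : P2 →₀ ℕ} (hD : DivisorOfSectionEq S f s D)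
    (hm : m.IsHomogeneous 1) {x : P2} (hx : x ∈ S) (hmx : pev m x ≠ 0) (h0 : D x = 0) {a : L.ι}
    (ha : pev (L.H a) x ≠ 0) : UnitRegAt S b (fun y => pev m y / coval s a y) x := by
  obtain ⟨c, hc⟩ := hs.2.1 x hx
  have hc' := H_toChart_ne_zero hs hx hc
  have hord := hD.2 x hx c hc
  rw [h0] at hord
  have hnum := hL.2.2.2.1 a (chartL s c) x hx ha hc'.1
  have hhom := hL.2.2.1 a (chartL s c)
  have hlden := hs.2.2.2.2.1 c x hx hc
  have hlhom := hs.2.2.2.1 c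
  have hlnum := pev_ne_zero_of_ordEq_zero hlhom.1 hord
  refine UnitRegAt.of_ratio (p := m * L.num a (chartL s c) * s.lden c)
    (q := s.lnum c * L.den a (chartL s c) * X (chartX s c)) (K := s.K c * L.H a)
    ((hm.mul hhom.1).mul hlhom.2) (e := s.Kdeg c + L.Hdeg a) ?_ ((hs.1 c).mul (hL.1 a))
    (by simp [hmx, hnum.1, hlden]) (by simp only [pev_mul]; simp [hlnum, hnum.2, hc'.2])
    (by simp [hc, ha]) ?_
  · convert (hlhom.1.mul hhom.2).mul (isHomogeneous_X ℂ (chartX s c)) using 1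
    omega
  · intro y hy _ hpy hqy hK
    simp only [pev_mul, ne_eq, mul_eq_zero, not_or] at hpy hqy hK
    rw [coval_eq hL hs hy hK.2 hK.1, BundleData.gval, TrivData.lval]
    simp only [pev_mul]
    have := hpy.1.2
    have := hpy.2
    have := hqy.1.1
    have := hqy.1.2
    have := hqy.2
    field_simp

namespace IsBitangentConfig

variable {A : ConicLineArrangement 2} {l : Fin 4 → MvPolynomial (Fin 3) ℂ}
  {Pt : Fin 4 → Fin 2 → P2} {L : BundleData A.plane}
  {s : TrivData (L.dual.tensor (OdC A.plane 1))} {D : P2 →₀ ℕ}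

lemma unitRegAt_div_coval (h : IsBitangentConfig A l Pt) {i j : Fin 4} (hij : i ≠ j)
    (hL : L.Valid) (hs : s.ValidSection) (hD : IsTangencyDivisor Pt i j D)
    (hsD : DivisorOfSectionEq A.plane (A.f 0 * A.f 1) s D) (k : Fin 2) {x : P2}
    (hx : x ∈ zeroLocus (A.f k)) {a : L.ι} (ha : pev (L.H a) x ≠ 0) :
    UnitRegAt (zeroLocus (A.f k)) (l i * l j)
      (fun y => pev (h.frame hij k).M y / coval s a y) x := by
  obtain ⟨k', hk⟩ := exists_ne k
  rw [mul_f_eq A hk.symm] at hsD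
  exact (h.frame hij k).unitRegAt_div_coval (h.f_hom k') hL hs hsD (A.curve_subset_plane k)
    (fun x _ => h.divisor_eq_zero hD) (fun x => h.divisor_eq_one hij hD hk.symm) hx ha

lemma isOrderTwo (h : IsBitangentConfig A l Pt) {i j : Fin 4} (hij : i ≠ j)
    (hL : L.Valid) (hs : s.ValidSection) (hD : IsTangencyDivisor Pt i j D)
    (hsD : DivisorOfSectionEq A.plane (A.f 0 * A.f 1) s D) : IsOrderTwo L := by
  have hN := (hL.tensor hL).tensor (trivBundle_valid A.plane).dual
  refine isTrivial_of_unitReg hN (b := l i * l j) (fun p y =>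
    pev (l i) y / coval s p.1.1 y * (pev (l j) y / coval s p.1.2 y)) ?_ ?_ ?_
  · intro p q y hy _ hp hq
    have hp' : pev (L.H p.1.1) y ≠ 0 ∧ pev (L.H p.1.2) y ≠ 0 := by
      have : pev (L.H p.1.1 * L.H p.1.2 * 1) y ≠ 0 := hp
      simpa using this
    have hq' : pev (L.H q.1.1) y ≠ 0 ∧ pev (L.H q.1.2) y ≠ 0 := by
      have : pev (L.H q.1.1 * L.H q.1.2 * 1) y ≠ 0 := hq
      simpa using this
    have hg : ((L.tensor L).tensor (trivBundle A.plane).dual).gval p q y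
        = L.gval p.1.1 q.1.1 y * L.gval p.1.2 q.1.2 y := by
      change pev (L.num p.1.1 q.1.1 * L.num p.1.2 q.1.2 * 1) y
        / pev (L.den p.1.1 q.1.1 * L.den p.1.2 q.1.2 * 1) y = _
      rw [mul_one, mul_one, pev_mul, pev_mul, BundleData.gval, BundleData.gval, div_mul_div_comm]
    rw [hg, ← coval_change hL hs hy hp'.1 hq'.1, ← coval_change hL hs hy hp'.2 hq'.2]
    have h1 := hL.gval_ne_zero hy hp'.1 hq'.1
    have h2 := hL.gval_ne_zero hy hp'.2 hq'.2
    field_simp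
  · intro x hx p hp
    have hp' : pev (L.H p.1.1) x ≠ 0 ∧ pev (L.H p.1.2) x ≠ 0 := by
      have : pev (L.H p.1.1 * L.H p.1.2 * 1) x ≠ 0 := hp
      simpa using this
    by_cases h0 : pev (l i * l j) x = 0
    · obtain ⟨k, hk⟩ := Set.mem_iUnion.mp hx
      obtain ⟨k', hk'⟩ := exists_ne k
      refine ((h.unitRegAt_div_coval hij hL hs hD hsD k hk hp'.1).mul
        (h.unitRegAt_div_coval hij hL hs hD hsD k hk hp'.2)).congr_of_subset (h.f_hom k')
        (h.divisor_eq_one hij hD hk'.symm hk h0).2 fun y hy _ hKy => ?_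
      have hyk := (mem_plane hk'.symm hy).resolve_right hKy
      refine ⟨hyk, ?_⟩
      have := ((h.frame hij k).pev_eq_zero_iff y).mp hyk
      rw [div_mul_div_comm, div_mul_div_comm, this, sq]
    · have hD0 := h.divisor_eq_zero hD h0
      rw [pev_mul, mul_eq_zero, not_or] at h0
      exact (unitRegAt_div_coval_of_eq_zero hL hs hsD (h.hom i) hx h0.1 hD0 hp'.1).mul
        (unitRegAt_div_coval_of_eq_zero hL hs hsD (h.hom j) hx h0.2 hD0 hp'.2)
  · intro x hx
    by_cases h0 : pev (l i * l j) x = 0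
    · obtain ⟨k, hk⟩ := Set.mem_iUnion.mp hx
      obtain ⟨k', hk'⟩ := exists_ne k
      have hfx := (h.divisor_eq_one hij hD hk'.symm hk h0).2
      rw [pev_mul, mul_eq_zero] at h0
      rcases h0 with h0 | h0
      · obtain rfl := h.eq_Pt hk h0
        refine ⟨A.f k' * l j, 3, (h.f_hom k').mul (h.hom j), ?_, fun y hy hb hG => ?_⟩
        · simp [hfx, h.line_Pt_ne_zero hij.symm k]
        · simp only [pev_mul, mul_eq_zero, ne_eq, not_or] at hb hG
          exact h.eq_Pt ((mem_plane hk'.symm hy).resolve_right hG.1) (hb.resolve_right hG.2)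
      · obtain rfl := h.eq_Pt hk h0
        refine ⟨A.f k' * l i, 3, (h.f_hom k').mul (h.hom i), ?_, fun y hy hb hG => ?_⟩
        · simp [hfx, h.line_Pt_ne_zero hij k]
        · simp only [pev_mul, mul_eq_zero, ne_eq, not_or] at hb hG
          exact h.eq_Pt ((mem_plane hk'.symm hy).resolve_right hG.1) (hb.resolve_left hG.2)
    · exact ⟨l i * l j, 2, (h.hom i).mul (h.hom j), h0, fun y _ hb hG => absurd hb hG⟩

end IsBitangentConfig

lemma polar_eq_eval {F : MvPolynomial (Fin 3) ℂ} (hF : F.IsHomogeneous 2) (v w : Fin 3 → ℂ) :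
    polar F v w = eval (v + w) F - eval v F - eval w F := by
  have h := polar_self hF (v + w)
  rw [polar_add_right, polar_add_left hF, polar_add_left hF, polar_self hF, polar_self hF,
    polar_comm hF w v] at h
  linear_combination h / 2

namespace ConicFrame

variable {F F' l l' : MvPolynomial (Fin 3) ℂ}

lemma eval_F (Φ : ConicFrame F l l') (v : Fin 3 → ℂ) :
    eval v F = Φ.κ * (eval v l * eval v l' - eval v Φ.M ^ 2) := by
  have := congrArg (eval v) Φ.eqn
  simpa using this

lemma polar_eq (Φ : ConicFrame F l l') (v w : Fin 3 → ℂ) :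
    polar F v w = Φ.κ * (eval v l * eval w l' + eval v l' * eval w l
      - 2 * eval v Φ.M * eval w Φ.M) := by
  rw [polar_eq_eval Φ.isHomogeneous, Φ.eval_F, Φ.eval_F, Φ.eval_F,
    eval_add_of_isHomogeneous_one Φ.hl, eval_add_of_isHomogeneous_one Φ.hl',
    eval_add_of_isHomogeneous_one Φ.hM]
  ring

lemma eval_eq (Φ : ConicFrame F l l') {g : MvPolynomial (Fin 3) ℂ} (hg : g.IsHomogeneous 1)
    (v : Fin 3 → ℂ) :
    eval v g = eval v l * eval Φ.e₁ g + eval v l' * eval Φ.e₂ g + eval v Φ.M * eval Φ.e₃ g := by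
  conv_lhs => rw [Φ.span v]
  exact Φ.eval_comb hg _ _ _

lemma param_ne_zero (Φ : ConicFrame F l l') (t : ℂ) : Φ.param t 1 ≠ 0 := fun h =>
  one_ne_zero (Φ.param_eq_zero h).2

lemma e₁_ne_zero (Φ : ConicFrame F l l') : Φ.e₁ ≠ 0 := fun h => by
  have := Φ.l_e₁
  rw [h, ← zero_smul ℂ (0 : Fin 3 → ℂ), eval_smul_of_isHomogeneous_one Φ.hl, zero_mul] at this
  exact zero_ne_one this

/-- The affine parametrization of a conic minus a point. -/
def point (Φ : ConicFrame F l l') (t : ℂ) : P2 :=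
  Projectivization.mk ℂ (Φ.param t 1) (Φ.param_ne_zero t)

lemma point_injective (Φ : ConicFrame F l l') : Function.Injective Φ.point := fun t t' h => by
  obtain ⟨c, hc⟩ := (Projectivization.mk_eq_mk_iff' ℂ _ _ _ _).mp h
  have h1 := congrArg (fun v => eval v l') hc
  have h2 := congrArg (fun v => eval v Φ.M) hc
  simp only [eval_smul_of_isHomogeneous_one Φ.hl', eval_smul_of_isHomogeneous_one Φ.hM, Φ.l'_param,
    Φ.M_param] at h1 h2
  have hc1 : c = 1 := by linear_combination h1
  rw [hc1] at h2
  linear_combination -h2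

lemma pev_point_eq_zero (Φ : ConicFrame F l l') {g : MvPolynomial (Fin 3) ℂ} {d : ℕ}
    (hg : g.IsHomogeneous d) (t : ℂ) : pev g (Φ.point t) = 0 ↔ eval (Φ.param t 1) g = 0 :=
  pev_mk_eq_zero hg _

lemma point_mem (Φ : ConicFrame F l l') (t : ℂ) : pev F (Φ.point t) = 0 :=
  (Φ.pev_point_eq_zero Φ.isHomogeneous t).mpr (Φ.F_param t 1)

lemma exists_point (Φ : ConicFrame F l l') {x : P2} (hx : pev F x = 0) (hl : pev l' x ≠ 0) :
    ∃ t, x = Φ.point t := by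
  obtain ⟨u, w, h⟩ := Φ.exists_param hx
  have hw : w ≠ 0 := by
    rintro rfl
    apply hl
    rw [pev, h, Φ.l'_param]
    simp
  refine ⟨u / w, ?_⟩
  rw [← x.mk_rep]
  refine (Projectivization.mk_eq_mk_iff' ℂ _ _ _ _).mpr ⟨w ^ 2, ?_⟩
  rw [h, param, param]
  simp only [smul_add, smul_smul]
  have e₁ : w ^ 2 * (u / w) ^ 2 = u ^ 2 := by field_simp
  have e₂ : w ^ 2 * (u / w * 1) = u * w := by field_simp
  rw [e₁, e₂, one_pow, mul_one]

/-- Two conics with the same pair of bitangents meet in two points along each of the two lines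
cut out by their chords of contact. -/
lemma ncard_eq_two (Φ : ConicFrame F l l') (Ψ : ConicFrame F' l l')
    (hl : ∀ x, pev F x = 0 → pev F' x = 0 → pev l x ≠ 0 ∧ pev l' x ≠ 0)
    (hgrad : ∀ x, pev F x = 0 → pev F' x = 0 →
      ¬ ∃ c : ℂ, ∀ m, pev (pderiv m F') x = c * pev (pderiv m F) x) :
    {x : P2 | pev F x = 0 ∧ pev Φ.M x = pev Ψ.M x}.ncard = 2 := by
  have hN : (Φ.M - Ψ.M).IsHomogeneous 1 := Φ.hM.sub Ψ.hM
  have hF' : ∀ x, pev F x = 0 → pev Φ.M x = pev Ψ.M x → pev F' x = 0 := fun x hx hM => by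
    rw [Ψ.pev_eq_zero_iff, ← hM]
    exact (Φ.pev_eq_zero_iff x).mp hx
  set α := eval Φ.e₁ (Φ.M - Ψ.M) with hα
  set β := eval Φ.e₂ (Φ.M - Ψ.M) with hβ
  set δ := eval Φ.e₃ (Φ.M - Ψ.M) with hδ
  have hNp : ∀ t, eval (Φ.param t 1) (Φ.M - Ψ.M) = α * t ^ 2 + δ * t + β := fun t => by
    rw [Φ.eval_param hN]
    ring
  have hpt : ∀ t, pev Φ.M (Φ.point t) = pev Ψ.M (Φ.point t) ↔ α * t ^ 2 + δ * t + β = 0 := by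
    intro t
    rw [← hNp, ← Φ.pev_point_eq_zero hN, pev_sub, sub_eq_zero]
  have hα0 : α ≠ 0 := by
    intro h0
    rw [hα, eval_sub, Φ.M_e₁, zero_sub, neg_eq_zero] at h0
    have h1 : eval Φ.e₁ F = 0 := by rw [Φ.eval_F, Φ.l'_e₁, Φ.M_e₁]; ring
    have h2 : eval Φ.e₁ F' = 0 := by rw [Ψ.eval_F, Φ.l'_e₁, h0]; ring
    refine (hl (Projectivization.mk ℂ Φ.e₁ Φ.e₁_ne_zero)
      ((pev_mk_eq_zero Φ.isHomogeneous _).mpr h1) ((pev_mk_eq_zero Ψ.isHomogeneous _).mpr h2)).2 ?_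
    exact (pev_mk_eq_zero Φ.hl' _).mpr Φ.l'_e₁
  obtain ⟨r, hr⟩ := IsAlgClosed.exists_pow_nat_eq (δ ^ 2 - 4 * α * β) two_pos
  have hr0 : r ≠ 0 := by
    rintro rfl
    have hroot : α * (-δ / (2 * α)) ^ 2 + δ * (-δ / (2 * α)) + β = 0 := by
      field_simp
      linear_combination hr
    have hM := (hpt _).mpr hroot
    set t := -δ / (2 * α) with ht
    have hF := Φ.point_mem t
    refine hgrad _ hF (hF' _ hF hM) ?_
    obtain ⟨a, ha, hrep⟩ := rep_mk (Φ.param_ne_zero t)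
    change (Φ.point t).rep = _ at hrep
    have hδ' : δ = -2 * α * t := by rw [ht]; field_simp
    have hβ' : β = α * t ^ 2 := by
      rw [hδ'] at hroot
      linear_combination hroot
    have hM' : eval (Φ.param t 1) Ψ.M = t := by
      have := hNp t
      rw [hroot, eval_sub, Φ.M_param] at this
      linear_combination -this
    have hκ := Φ.hκ
    clear_value t
    refine ⟨Ψ.κ / Φ.κ * (1 + 2 * t * α), fun m => ?_⟩
    rw [pev, pev, ← polar_single, ← polar_single, hrep, polar_smul_left Φ.isHomogeneous,
      polar_smul_left Ψ.isHomogeneous, Φ.polar_eq, Ψ.polar_eq, hM', Φ.l_param, Φ.l'_param,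
      Φ.M_param]
    have := Φ.eval_eq hN (Pi.single m 1)
    rw [eval_sub, ← hα, ← hβ, ← hδ, hδ', hβ'] at this
    field_simp
    linear_combination 2 * t * Ψ.κ * this
  have hfac : ∀ t, α * t ^ 2 + δ * t + β
      = α * (t - (-δ + r) / (2 * α)) * (t - (-δ - r) / (2 * α)) := fun t => by
    field_simp
    linear_combination hr
  rw [Set.ncard_eq_two]
  refine ⟨Φ.point ((-δ + r) / (2 * α)), Φ.point ((-δ - r) / (2 * α)), fun h => hr0 ?_, ?_⟩
  · have := Φ.point_injective h
    field_simp at this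
    linear_combination this / 2
  · ext x
    simp only [Set.mem_ofPred_eq, Set.mem_insert_iff, Set.mem_singleton_iff]
    constructor
    · rintro ⟨hx, hM⟩
      obtain ⟨t, rfl⟩ := Φ.exists_point hx (hl x hx (hF' x hx hM)).2
      have := (hpt t).mp hM
      rw [hfac, mul_eq_zero, mul_eq_zero, or_iff_right hα0, sub_eq_zero, sub_eq_zero] at this
      exact this.imp (congrArg _) (congrArg _)
    · rintro (rfl | rfl) <;> refine ⟨Φ.point_mem _, (hpt _).mpr ?_⟩ <;> rw [hfac] <;> ring

end ConicFrame

/-- Two nowhere vanishing rational sections along a conic differ by a nonzero constant. -/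
lemma IsUnitSection.exists_const {F l l' b : MvPolynomial (Fin 3) ℂ} (Φ : ConicFrame F l l')
    {S₀ : Set P2} {N : BundleData S₀} (hN : N.Valid) (hS : zeroLocus F ⊆ S₀)
    {t u : N.ι → P2 → ℂ} (ht : IsUnitSection N (zeroLocus F) t) {n : ℕ} (hb : b.IsHomogeneous n)
    (hu : ∀ a a', ∀ y ∈ zeroLocus F, pev (N.H a) y ≠ 0 → pev (N.H a') y ≠ 0 →
      u a y = N.gval a a' y * u a' y)
    (hreg : ∀ x ∈ zeroLocus F, ∀ a, pev (N.H a) x ≠ 0 → UnitRegAt (zeroLocus F) b (u a) x)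
    {y₀ : P2} (hy₀ : y₀ ∈ zeroLocus F) (hb₀ : pev b y₀ ≠ 0) :
    ∃ r : ℂ, r ≠ 0 ∧ ∀ y ∈ zeroLocus F, pev b y ≠ 0 → ∀ a, pev (N.H a) y ≠ 0 →
      t a y = r * u a y := by
  classical
  have hcov : ∀ y ∈ zeroLocus F, ∃ a, pev (N.H a) y ≠ 0 := fun y hy => hN.2.1 y (hS hy)
  choose ch hch using hcov
  set g : P2 → ℂ := fun y => if hy : y ∈ zeroLocus F then t (ch y hy) y / u (ch y hy) y else 0
    with hg
  have hga : ∀ y ∈ zeroLocus F, ∀ a, pev (N.H a) y ≠ 0 → g y = t a y / u a y := by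
    intro y hy a ha
    have h1 := ht.change _ a y hy (hch y hy) ha
    have h2 := hu _ a y hy (hch y hy) ha
    simp only [hg, dif_pos hy, h1, h2]
    rw [mul_div_mul_left _ _ (hN.gval_ne_zero (hS hy) (hch y hy) ha)]
  have hgreg : ∀ x ∈ zeroLocus F, UnitRegAt (zeroLocus F) b g x := by
    intro x hx
    refine (((ht.reg x hx _ (hch x hx)).of_one b).div (hreg x hx _ (hch x hx))).congr (hN.1 _)
      (hch x hx) fun y hy _ hy' => hga y hy _ hy'
  refine ⟨g y₀, (hgreg y₀ hy₀).ne_zero hy₀ hb₀, fun y hy hby a ha => ?_⟩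
  rw [Φ.unitReg_const hb hgreg hy₀ hy hb₀ hby, hga y hy a ha,
    div_mul_cancel₀ _ ((hreg y hy a ha).ne_zero hy hby)]

namespace IsBitangentConfig

variable {A : ConicLineArrangement 2} {l : Fin 4 → MvPolynomial (Fin 3) ℂ}
  {Pt : Fin 4 → Fin 2 → P2} {L : BundleData A.plane}
  {s : TrivData (L.dual.tensor (OdC A.plane 1))} {D : P2 →₀ ℕ}

lemma mem_sing_iff (A : ConicLineArrangement 2) (x : P2) :
    x ∈ A.sing ↔ pev (A.f 0) x = 0 ∧ pev (A.f 1) x = 0 := by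
  constructor
  · rintro ⟨i, j, hij, hi, hj⟩
    fin_cases i <;> fin_cases j
    · exact absurd rfl hij
    · exact ⟨hi, hj⟩
    · exact ⟨hj, hi⟩
    · exact absurd rfl hij
  · rintro ⟨h0, h1⟩
    exact ⟨0, 1, by decide, h0, h1⟩

lemma div_coval_change {i j : Fin 4} (h : IsBitangentConfig A l Pt) (hij : i ≠ j) (hL : L.Valid)
    (hs : s.ValidSection) (k : Fin 2) {a a' : L.ι} {y : P2} (hy : y ∈ zeroLocus (A.f k))
    (ha : pev (L.H a) y ≠ 0) (ha' : pev (L.H a') y ≠ 0) :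
    pev (h.frame hij k).M y / coval s a y
      = L.gval a a' y * (pev (h.frame hij k).M y / coval s a' y) := by
  have hy' := A.curve_subset_plane k hy
  rw [← coval_change hL hs hy' ha ha']
  have := hL.gval_ne_zero hy' ha ha'
  field_simp

lemma chord_mem {i j : Fin 4} (h : IsBitangentConfig A l Pt) (hij : i ≠ j) {x : P2}
    (hx : x ∈ A.sing) : pev (h.frame hij 0).M x ^ 2 = pev (h.frame hij 1).M x ^ 2 ∧
      pev (h.frame hij 0).M x ≠ 0 := by
  rw [mem_sing_iff] at hx
  have h0 := ((h.frame hij 0).pev_eq_zero_iff x).mp hx.1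
  have h1 := ((h.frame hij 1).pev_eq_zero_iff x).mp hx.2
  refine ⟨h0.symm.trans h1, fun hM => ?_⟩
  rw [hM, zero_pow two_ne_zero, mul_eq_zero] at h0
  have h01 : (0 : Fin 2) ≠ 1 := by decide
  exact h0.elim (h.line_ne_zero h01 hx.1 hx.2) (h.line_ne_zero h01 hx.1 hx.2)

lemma ncard_chord {i j : Fin 4} (h : IsBitangentConfig A l Pt) (hij : i ≠ j) :
    {x ∈ A.sing | pev (h.frame hij 0).M x = pev (h.frame hij 1).M x}.ncard = 2 ∧
    {x ∈ A.sing | pev (h.frame hij 0).M x = -pev (h.frame hij 1).M x}.ncard = 2 := by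
  have h01 : (0 : Fin 2) ≠ 1 := by decide
  have hl : ∀ x, pev (A.f 0) x = 0 → pev (A.f 1) x = 0 → pev (l i) x ≠ 0 ∧ pev (l j) x ≠ 0 :=
    fun x h0 h1 => ⟨h.line_ne_zero h01 h0 h1, h.line_ne_zero h01 h0 h1⟩
  have hgrad : ∀ x, pev (A.f 0) x = 0 → pev (A.f 1) x = 0 →
      ¬ ∃ c : ℂ, ∀ m, pev (pderiv m (A.f 1)) x = c * pev (pderiv m (A.f 0)) x :=
    fun x h0 h1 => (A.nodes 0 1 h01 x ⟨h0, h1⟩).2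
  constructor
  · refine (congrArg Set.ncard (Set.ext fun x => ?_)).trans
      ((h.frame hij 0).ncard_eq_two (h.frame hij 1) hl hgrad)
    simp only [Set.mem_ofPred_eq, mem_sing_iff, (h.frame hij 0).pev_eq_zero_iff,
      (h.frame hij 1).pev_eq_zero_iff]
    exact ⟨fun hx => ⟨hx.1.1, hx.2⟩, fun hx => ⟨⟨hx.1, hx.1.trans (by rw [hx.2])⟩, hx.2⟩⟩
  · refine (congrArg Set.ncard (Set.ext fun x => ?_)).trans
      ((h.frame hij 0).ncard_eq_two (h.frame hij 1).neg hl hgrad)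
    have hneg : pev (h.frame hij 1).neg.M x = -pev (h.frame hij 1).M x := pev_neg _ _
    simp only [Set.mem_ofPred_eq, mem_sing_iff, (h.frame hij 0).pev_eq_zero_iff,
      (h.frame hij 1).pev_eq_zero_iff, hneg]
    exact ⟨fun hx => ⟨hx.1.1, hx.2⟩,
      fun hx => ⟨⟨hx.1, hx.1.trans (by rw [hx.2, neg_sq])⟩, hx.2⟩⟩

lemma ncard_gluing {i j : Fin 4} (h : IsBitangentConfig A l Pt) (hij : i ≠ j) {r₀ r₁ : ℂ}
    (hr₁ : r₁ ≠ 0) {κ : GluingData A}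
    (hκ : ∀ Q, r₀ * pev (h.frame hij 0).M Q.1 = signC (κ Q) * (r₁ * pev (h.frame hij 1).M Q.1)) :
    {Q | κ Q = true}.ncard = 2 ∧ {Q | κ Q = false}.ncard = 2 := by
  obtain ⟨h1, h2⟩ := h.ncard_chord hij
  have himg : ∀ (p : P2 → Prop), {Q : {Q : P2 // Q ∈ A.sing} | p Q.1}.ncard
      = {x ∈ A.sing | p x}.ncard := by
    intro p
    rw [← Set.ncard_image_of_injective _ Subtype.val_injective]
    congr 1
    ext x
    simp [and_comm]
  obtain ⟨ε, hε, hr⟩ : ∃ ε : ℂ, (ε = 1 ∨ ε = -1) ∧ r₀ = ε * r₁ := by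
    obtain ⟨x, hx, hxM⟩ := Set.nonempty_of_ncard_ne_zero (h1.trans_ne two_ne_zero)
    refine ⟨signC (κ ⟨x, hx⟩), by cases κ ⟨x, hx⟩ <;> simp [signC], ?_⟩
    have h3 := hκ ⟨x, hx⟩
    have h4 := (h.chord_mem hij hx).2
    rw [← hxM] at h3
    apply mul_right_cancel₀ h4
    linear_combination h3
  have key : ∀ Q, ε * pev (h.frame hij 0).M Q.1 = signC (κ Q) * pev (h.frame hij 1).M Q.1 := by
    intro Q
    apply mul_left_cancel₀ hr₁
    have := hκ Q
    rw [hr] at this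
    linear_combination this
  have hM1 : ∀ Q : {Q : P2 // Q ∈ A.sing}, pev (h.frame hij 1).M Q.1 ≠ 0 := fun Q h0 => by
    obtain ⟨h3, h4⟩ := h.chord_mem hij Q.2
    rw [h0, zero_pow two_ne_zero] at h3
    exact h4 (pow_eq_zero_iff two_ne_zero |>.mp h3)
  have hne : ∀ z : ℂ, z ≠ 0 → z ≠ -z := fun z hz e => hz (by linear_combination e / 2)
  have hset : ∀ (b : Bool) (p : P2 → Prop), (∀ Q, κ Q = b ↔ p Q.1) →
      {x ∈ A.sing | p x}.ncard = 2 → {Q | κ Q = b}.ncard = 2 := fun b p hp h2 =>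
    (congrArg Set.ncard (Set.ext hp)).trans ((himg p).trans h2)
  rcases hε with rfl | rfl
  · refine ⟨hset _ _ (fun Q => ?_) h1, hset _ _ (fun Q => ?_) h2⟩ <;> have h3 := key Q <;>
      have h4 := hne _ (hM1 Q) <;> cases hQ : κ Q <;> rw [hQ] at h3 <;>
      simp only [signC, if_true, if_false, one_mul, neg_mul, Bool.false_eq_true] at h3 <;>
      simp [h3, h4, h4.symm]
  · refine ⟨hset _ _ (fun Q => ?_) h2, hset _ _ (fun Q => ?_) h1⟩ <;> have h3 := key Q <;>
      have h4 := hne _ (hM1 Q) <;> cases hQ : κ Q <;> rw [hQ] at h3 <;>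
      simp only [signC, if_true, if_false, one_mul, neg_mul, Bool.false_eq_true,
        neg_eq_iff_eq_neg] at h3 <;>
      simp [h3, h4, h4.symm]

end IsBitangentConfig

namespace IsBitangentConfig

variable {A : ConicLineArrangement 2} {l : Fin 4 → MvPolynomial (Fin 3) ℂ}
  {Pt : Fin 4 → Fin 2 → P2} {L : BundleData A.plane}
  {s : TrivData (L.dual.tensor (OdC A.plane 1))} {D : P2 →₀ ℕ}

lemma sing_mem (A : ConicLineArrangement 2) {x : P2} (hx : x ∈ A.sing) (k : Fin 2) :
    x ∈ zeroLocus (A.f k) := by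
  rw [mem_sing_iff] at hx
  fin_cases k
  · exact hx.1
  · exact hx.2

lemma line_sing_ne_zero (h : IsBitangentConfig A l Pt) (i : Fin 4) {x : P2} (hx : x ∈ A.sing) :
    pev (l i) x ≠ 0 :=
  h.line_ne_zero (by decide) (sing_mem A hx 0) (sing_mem A hx 1)

lemma sing_nonempty (h : IsBitangentConfig A l Pt) : A.sing.Nonempty := by
  have hij : (0 : Fin 4) ≠ 1 := by decide
  obtain ⟨x, hx, -⟩ := Set.nonempty_of_ncard_ne_zero ((h.ncard_chord hij).1.trans_ne two_ne_zero)
  exact ⟨x, hx⟩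

lemma ncard_sing (h : IsBitangentConfig A l Pt) : A.sing.ncard = 4 := by
  have hij : (0 : Fin 4) ≠ 1 := by decide
  obtain ⟨h1, h2⟩ := h.ncard_chord hij
  have hu := Set.ncard_union_eq (s := {x ∈ A.sing | pev (h.frame hij 0).M x
      = pev (h.frame hij 1).M x}) (t := {x ∈ A.sing | pev (h.frame hij 0).M x
      = -pev (h.frame hij 1).M x}) ?_ (Set.finite_of_ncard_ne_zero (h1.trans_ne two_ne_zero))
    (Set.finite_of_ncard_ne_zero (h2.trans_ne two_ne_zero))
  · rw [h1, h2] at hu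
    refine Eq.trans (congrArg Set.ncard (Set.ext fun x => ?_)) hu
    refine ⟨fun hx => ?_, fun hx => hx.elim And.left And.left⟩
    exact (sq_eq_sq_iff_eq_or_eq_neg.mp (h.chord_mem hij hx).1).imp (⟨hx, ·⟩) (⟨hx, ·⟩)
  · rw [Set.disjoint_left]
    rintro x ⟨hx, h3⟩ ⟨-, h4⟩
    apply (h.chord_mem hij hx).2
    linear_combination h3 / 2 + h4 / 2

lemma exists_const (h : IsBitangentConfig A l Pt) {i j : Fin 4} (hij : i ≠ j) (hL : L.Valid)
    (hs : s.ValidSection) (hD : IsTangencyDivisor Pt i j D)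
    (hsD : DivisorOfSectionEq A.plane (A.f 0 * A.f 1) s D) (k : Fin 2) {t : L.ι → P2 → ℂ}
    (ht : IsUnitSection L (zeroLocus (A.f k)) t) :
    ∃ r : ℂ, r ≠ 0 ∧ ∀ y ∈ A.sing, ∀ a, pev (L.H a) y ≠ 0 →
      t a y = r * (pev (h.frame hij k).M y / coval s a y) := by
  obtain ⟨y₀, hy₀⟩ := h.sing_nonempty
  have hb : ∀ y ∈ A.sing, pev (l i * l j) y ≠ 0 := fun y hy => by
    simp [h.line_sing_ne_zero _ hy]
  obtain ⟨r, hr, hrt⟩ := ht.exists_const (h.frame hij k) hL (A.curve_subset_plane k)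
    ((h.hom i).mul (h.hom j)) (fun a a' y hy ha ha' => h.div_coval_change hij hL hs k hy ha ha')
    (fun x hx a ha => h.unitRegAt_div_coval hij hL hs hD hsD k hx ha) (sing_mem A hy₀ k)
    (hb y₀ hy₀)
  exact ⟨r, hr, fun y hy a ha => hrt y (sing_mem A hy k) (hb y hy) a ha⟩

lemma coval_sing_ne_zero (h : IsBitangentConfig A l Pt) {i j : Fin 4} (hL : L.Valid)
    (hs : s.ValidSection) (hD : IsTangencyDivisor Pt i j D)
    (hsD : DivisorOfSectionEq A.plane (A.f 0 * A.f 1) s D) {x : P2} (hx : x ∈ A.sing) {a : L.ι}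
    (ha : pev (L.H a) x ≠ 0) : coval s a x ≠ 0 :=
  coval_ne_zero hL hs hsD (A.curve_subset_plane 0 (sing_mem A hx 0)) ha
    (h.divisor_eq_zero hD (by simp [h.line_sing_ne_zero _ hx]))

lemma ncard_of_sections (h : IsBitangentConfig A l Pt) {i j : Fin 4} (hij : i ≠ j) (hL : L.Valid)
    (hs : s.ValidSection) (hD : IsTangencyDivisor Pt i j D)
    (hsD : DivisorOfSectionEq A.plane (A.f 0 * A.f 1) s D) {t₀ t₁ : L.ι → P2 → ℂ}
    (ht₀ : IsUnitSection L (zeroLocus (A.f 0)) t₀) (ht₁ : IsUnitSection L (zeroLocus (A.f 1)) t₁)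
    {κ : GluingData A}
    (hκ : ∀ Q a, pev (L.H a) Q.1 ≠ 0 → t₀ a Q.1 = signC (κ Q) * t₁ a Q.1) :
    {Q | κ Q = true}.ncard = 2 ∧ {Q | κ Q = false}.ncard = 2 := by
  obtain ⟨r₀, -, h₀⟩ := h.exists_const hij hL hs hD hsD 0 ht₀
  obtain ⟨r₁, hr₁, h₁⟩ := h.exists_const hij hL hs hD hsD 1 ht₁
  refine h.ncard_gluing hij (r₀ := r₀) hr₁ fun Q => ?_
  obtain ⟨a, ha⟩ := hL.2.1 Q.1 (A.curve_subset_plane 0 (sing_mem A Q.2 0))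
  have hc := h.coval_sing_ne_zero hL hs hD hsD Q.2 ha
  have := hκ Q a ha
  rw [h₀ _ Q.2 a ha, h₁ _ Q.2 a ha] at this
  field_simp at this
  linear_combination this

lemma ncard_of_isSheafGluingDataOf (h : IsBitangentConfig A l Pt) {i j : Fin 4} (hij : i ≠ j)
    (hL : L.Valid) (hs : s.ValidSection) (hD : IsTangencyDivisor Pt i j D)
    (hsD : DivisorOfSectionEq A.plane (A.f 0 * A.f 1) s D) {κ : GluingData A}
    (hκ : IsSheafGluingDataOf A L κ) :
    {Q | κ Q = true}.ncard = 2 ∧ {Q | κ Q = false}.ncard = 2 := by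
  obtain ⟨T, hT, hglue⟩ := hκ
  refine h.ncard_of_sections hij hL hs hD hsD
    (IsUnitSection.of_restrict hL (A.curve_subset_plane 0) (hT 0))
    (IsUnitSection.of_restrict hL (A.curve_subset_plane 1) (hT 1)) fun Q a ha => ?_
  have h0 := sing_mem A Q.2 0
  have h1 := sing_mem A Q.2 1
  obtain ⟨c, hc⟩ := (hT 0).1.2.1 _ h0
  obtain ⟨c', hc'⟩ := (hT 1).1.2.1 _ h1
  have e0 := (hT 0).1.val_eq (hL.restrict (A.curve_subset_plane 0)) h0 (a := a) ha hc
  have e1 := (hT 1).1.val_eq (hL.restrict (A.curve_subset_plane 1)) h1 (a := a) ha hc'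
  refine e0.trans ((hglue Q 0 1 (by decide) h0 h1 a ha c c' hc hc').trans ?_)
  exact congrArg (signC (κ Q) * ·) e1.symm

lemma not_bIso_trivBundle (h : IsBitangentConfig A l Pt) {i j : Fin 4} (hij : i ≠ j)
    (hL : L.Valid) (hs : s.ValidSection) (hD : IsTangencyDivisor Pt i j D)
    (hsD : DivisorOfSectionEq A.plane (A.f 0 * A.f 1) s D) : ¬ BIso L (trivBundle A.plane) := by
  rintro ⟨T, hT⟩
  have hN := hL.tensor (trivBundle_valid A.plane).dual
  have hH : ∀ a y, pev ((L.tensor (trivBundle A.plane).dual).H (a, ())) y = pev (L.H a) y :=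
    fun a y => by
      change pev (L.H a * 1) y = _
      rw [mul_one]
  have hg : ∀ a b y, (L.tensor (trivBundle A.plane).dual).gval (a, ()) (b, ()) y = L.gval a b y :=
    fun a b y => by
      change pev (L.num a b * 1) y / pev (L.den a b * 1) y = _
      rw [mul_one, mul_one]
      rfl
  have ht : ∀ k, IsUnitSection L (zeroLocus (A.f k)) fun a => T.val (a, ()) := fun k =>
    { change := fun a b y hy ha hb =>
        (hT.1.val_eq_gval_mul hN (A.curve_subset_plane k hy) ((hH a y).trans_ne ha)
          ((hH b y).trans_ne hb)).trans (congrArg (· * T.val (b, ()) y) (hg a b y))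
      reg := fun x hx a ha => (hT.unitRegAt_val hN (A.curve_subset_plane k hx)
        ((hH a x).trans_ne ha)).subset (A.curve_subset_plane k) }
  have := (h.ncard_of_sections hij hL hs hD hsD (ht 0) (ht 1) (κ := fun _ => true)
    fun Q a _ => by simp [signC]).2
  simp at this

/-- The gluing functions of two sheaves sharing one bitangent are not proportional at the nodes. -/
lemma exists_chord_ne (h : IsBitangentConfig A l Pt) {i j k : Fin 4} (hij : i ≠ j) (hik : i ≠ k)
    (hjk : j ≠ k) {r₀ r₁ : ℂ} (hr₁ : r₁ ≠ 0) :
    ∃ x ∈ A.sing, r₀ * (pev (h.frame hij 0).M x * pev (h.frame hik 1).M x)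
      ≠ r₁ * (pev (h.frame hij 1).M x * pev (h.frame hik 0).M x) := by
  by_contra! hrel
  set Φ := h.frame hij 0 with hΦ
  have hF₁ : eval Φ.e₁ (A.f 0) = 0 := by rw [Φ.eval_F, Φ.l'_e₁, Φ.M_e₁]; ring
  have hF₂ : eval Φ.e₂ (A.f 0) = 0 := by rw [Φ.eval_F, Φ.l_e₂, Φ.M_e₂]; ring
  have hx₁ := (pev_mk_eq_zero (h.f_hom 0) Φ.e₁_ne_zero).mpr hF₁
  have hlj := (pev_mk_eq_zero (h.hom j) Φ.e₁_ne_zero).mpr Φ.l'_e₁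
  have hc0 : eval Φ.e₂ (h.frame hik 0).M = 0 := by
    rw [(h.frame hik 0).eval_eq_zero_iff, Φ.l_e₂, zero_mul] at hF₂
    exact pow_eq_zero_iff two_ne_zero |>.mp hF₂.symm
  have hc2 : eval Φ.e₁ (h.frame hik 0).M ≠ 0 := by
    intro h0
    rw [(h.frame hik 0).eval_eq_zero_iff, Φ.l_e₁, h0, one_mul, zero_pow two_ne_zero] at hF₁
    exact h.Pt_ne' hjk 0 0 ((h.eq_Pt hx₁ hlj).symm.trans
      (h.eq_Pt hx₁ ((pev_mk_eq_zero (h.hom k) Φ.e₁_ne_zero).mpr hF₁)))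
  have hb2 : eval Φ.e₁ (h.frame hij 1).M ≠ 0 := by
    intro h0
    have hF' : eval Φ.e₁ (A.f 1) = 0 := by
      rw [(h.frame hij 1).eval_F, Φ.l'_e₁, h0]
      ring
    exact h.line_ne_zero (by decide) hx₁ ((pev_mk_eq_zero (h.f_hom 1) Φ.e₁_ne_zero).mpr hF') hlj
  have hcard : (Φ.point ⁻¹' A.sing).ncard = 4 := by
    refine (Set.ncard_preimage_of_injective_subset_range Φ.point_injective fun x hx => ?_).trans
      h.ncard_sing
    obtain ⟨t, rfl⟩ := Φ.exists_point (sing_mem A hx 0) (h.line_sing_ne_zero j hx)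
    exact ⟨t, rfl⟩
  have hfin := Set.finite_of_ncard_ne_zero (hcard.trans_ne four_ne_zero)
  set a₀ := eval Φ.e₂ (h.frame hik 1).M
  set a₁ := eval Φ.e₃ (h.frame hik 1).M
  set a₂ := eval Φ.e₁ (h.frame hik 1).M
  set b₀ := eval Φ.e₂ (h.frame hij 1).M
  set b₁ := eval Φ.e₃ (h.frame hij 1).M
  set b₂ := eval Φ.e₁ (h.frame hij 1).M
  set c₁ := eval Φ.e₃ (h.frame hik 0).M
  set c₂ := eval Φ.e₁ (h.frame hik 0).M
  set p : Cubic ℂ := ⟨r₁ * b₂ * c₂, r₁ * (b₂ * c₁ + b₁ * c₂) - r₀ * a₂,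
    r₁ * (b₁ * c₁ + b₀ * c₂) - r₀ * a₁, r₁ * b₀ * c₁ - r₀ * a₀⟩ with hp
  have hp0 : p.toPoly = 0 := by
    refine Polynomial.eq_zero_of_natDegree_lt_card_of_eval_eq_zero' p.toPoly hfin.toFinset ?_ ?_
    · intro t ht
      rw [Set.Finite.mem_toFinset] at ht
      have ht : Φ.point t ∈ A.sing := ht
      obtain ⟨c, hc, hrep⟩ := rep_mk (Φ.param_ne_zero t)
      have hrep : (Φ.point t).rep = c • Φ.param t 1 := hrep
      have hM : pev Φ.M (Φ.point t) ≠ 0 := (h.chord_mem hij ht).2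
      have h1 := hrel _ ht
      rw [pev, hrep, eval_smul_of_isHomogeneous_one Φ.hM, Φ.M_param, mul_one] at hM h1
      rw [pev, pev, pev, hrep, eval_smul_of_isHomogeneous_one (h.frame hik 1).hM,
        eval_smul_of_isHomogeneous_one (h.frame hij 1).hM,
        eval_smul_of_isHomogeneous_one (h.frame hik 0).hM, Φ.eval_param (h.frame hik 1).hM,
        Φ.eval_param (h.frame hij 1).hM, Φ.eval_param (h.frame hik 0).hM, hc0] at h1
      apply mul_left_cancel₀ (mul_ne_zero hc hM)
      simp only [Cubic.toPoly, hp, Polynomial.eval_add, Polynomial.eval_mul, Polynomial.eval_C,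
        Polynomial.eval_pow, Polynomial.eval_X]
      linear_combination -h1
    · rw [← Set.ncard_eq_toFinset_card _ hfin, hcard]
      exact Nat.lt_succ_of_le Polynomial.natDegree_cubic_le
  have := congrArg Cubic.a (p.toPoly_eq_zero_iff.mp hp0)
  exact mul_ne_zero (mul_ne_zero hr₁ hb2) hc2 this

lemma not_bIso (h : IsBitangentConfig A l Pt) {i j k : Fin 4} (hij : i ≠ j) (hik : i ≠ k)
    (hjk : j ≠ k) {L' : BundleData A.plane} {s' : TrivData (L'.dual.tensor (OdC A.plane 1))}
    {D' : P2 →₀ ℕ} (hL : L.Valid) (hs : s.ValidSection) (hD : IsTangencyDivisor Pt i j D)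
    (hsD : DivisorOfSectionEq A.plane (A.f 0 * A.f 1) s D) (hL' : L'.Valid)
    (hs' : s'.ValidSection) (hD' : IsTangencyDivisor Pt i k D')
    (hsD' : DivisorOfSectionEq A.plane (A.f 0 * A.f 1) s' D') : ¬ BIso L L' := by
  rintro ⟨T, hT⟩
  have hN := hL.tensor hL'.dual
  have hH : ∀ p y, pev ((L.tensor L'.dual).H p) y ≠ 0 →
      pev (L.H p.1) y ≠ 0 ∧ pev (L'.H p.2) y ≠ 0 := fun p y hp => by
    have hp : pev (L.H p.1 * L'.H p.2) y ≠ 0 := hp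
    simpa using hp
  have hg : ∀ p q y, (L.tensor L'.dual).gval p q y = L.gval p.1 q.1 y / L'.gval p.2 q.2 y :=
    fun p q y => by
      change pev (L.num p.1 q.1 * L'.den p.2 q.2) y / pev (L.den p.1 q.1 * L'.num p.2 q.2) y = _
      rw [pev_mul, pev_mul]
      exact (div_div_div_eq _ _ _ _).symm
  have ht : ∀ m, IsUnitSection (L.tensor L'.dual) (zeroLocus (A.f m)) T.val := fun m =>
    { change := fun a b y hy ha hb => hT.1.val_eq_gval_mul hN (A.curve_subset_plane m hy) ha hb
      reg := fun x hx a ha =>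
        (hT.unitRegAt_val hN (A.curve_subset_plane m hx) ha).subset (A.curve_subset_plane m) }
  obtain ⟨y₀, hy₀⟩ := h.sing_nonempty
  have hb : ∀ y ∈ A.sing, pev (l i * l j * l k) y ≠ 0 := fun y hy => by
    simp [h.line_sing_ne_zero _ hy]
  have hconst : ∀ m, ∃ r : ℂ, r ≠ 0 ∧ ∀ y ∈ A.sing, ∀ p, pev ((L.tensor L'.dual).H p) y ≠ 0 →
      T.val p y = r * (pev (h.frame hij m).M y / coval s p.1 y
        / (pev (h.frame hik m).M y / coval s' p.2 y)) := by
    intro m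
    obtain ⟨r, hr, hrt⟩ := (ht m).exists_const (b := l i * l j * l k) (u := fun p y =>
      pev (h.frame hij m).M y / coval s p.1 y / (pev (h.frame hik m).M y / coval s' p.2 y))
      (h.frame hij m) hN (A.curve_subset_plane m) (((h.hom i).mul (h.hom j)).mul (h.hom k))
      (fun p q y hy hp hq => by
        have h1 := h.div_coval_change hij hL hs m hy (hH p y hp).1 (hH q y hq).1
        have h2 := h.div_coval_change hik hL' hs' m hy (hH p y hp).2 (hH q y hq).2
        rw [h1, h2, hg, mul_div_mul_comm])
      (fun x hx p hp =>
        ((h.unitRegAt_div_coval hij hL hs hD hsD m hx (hH p x hp).1).mono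
          fun y hy => by simp_all).div
        ((h.unitRegAt_div_coval hik hL' hs' hD' hsD' m hx (hH p x hp).2).mono
          fun y hy => by simp_all))
      (sing_mem A hy₀ m) (hb y₀ hy₀)
    exact ⟨r, hr, fun y hy p hp => hrt y (sing_mem A hy m) (hb y hy) p hp⟩
  obtain ⟨r₀, -, h₀⟩ := hconst 0
  obtain ⟨r₁, hr₁, h₁⟩ := hconst 1
  obtain ⟨x, hx, hne⟩ := h.exists_chord_ne hij hik hjk (r₀ := r₀) hr₁
  apply hne
  obtain ⟨p, hp⟩ := hN.2.1 x (A.curve_subset_plane 0 (sing_mem A hx 0))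
  have he := (h₀ x hx p hp).symm.trans (h₁ x hx p hp)
  have hc := h.coval_sing_ne_zero hL hs hD hsD hx (hH p x hp).1
  have hc' := h.coval_sing_ne_zero hL' hs' hD' hsD' hx (hH p x hp).2
  have hM0 := (h.chord_mem hik hx).2
  have hM1 : pev (h.frame hik 1).M x ≠ 0 := fun h0 => by
    have := (h.chord_mem hik hx).1
    rw [h0, zero_pow two_ne_zero] at this
    exact hM0 (pow_eq_zero_iff two_ne_zero |>.mp this)
  field_simp at he
  linear_combination he

end IsBitangentConfig

section Statement12

/-- Let `C₁, C₂ ⊂ ℙ²(ℂ)` be smooth conics intersecting transversely,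
`C = C₁ + C₂` (a conic-line arrangement with simple nodes), let `T₁, …, T₄` be the four
common bitangent lines with tangency points `P_{ik} = T_i ∩ C_k`, and for `i ≠ j` let
`ℱ_{ij} = 𝒪_{ℙ²}(1)|_C ⊗ 𝒪_C(-P_{i1}-P_{i2}-P_{j1}-P_{j2})`.  Then each `ℱ_{ij}` is a
nontrivial invertible sheaf of order 2 on `C` whose gluing data (with respect to the four
nodes of `C`) has exactly two `+`'s and two `-`'s, and for any three distinct indices
`i, j, k` the sheaves `ℱ_{ij}, ℱ_{ik}, ℱ_{jk}` are pairwise non-isomorphic; in particular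
`ℱ_{ij} ≇ ℱ_{ik}` whenever `j ≠ k`. -/
theorem statement12 (A : ConicLineArrangement 2) (hdeg : ∀ i, A.deg i = 2)
    (l : Fin 4 → MvPolynomial (Fin 3) ℂ)
    (hlhom : ∀ i, (l i).IsHomogeneous 1) (hlne : ∀ i, l i ≠ 0)
    (hldist : ∀ i j, i ≠ j → zeroLocus (l i) ≠ zeroLocus (l j))
    (Pt : Fin 4 → Fin 2 → P2)
    (htan : ∀ i kk, IsTangentLineAt (l i) (A.f kk) (Pt i kk)) :
    (∀ i j : Fin 4, i ≠ j → ∀ (D : P2 →₀ ℕ) (L : BundleData A.plane),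
      IsTangencyDivisor Pt i j D → L.Valid →
      RepOdMinus A.plane (A.f 0 * A.f 1) 1 L D →
      ¬ BIso L (trivBundle A.plane) ∧ IsOrderTwo L ∧
      (∀ κ : GluingData A, IsSheafGluingDataOf A L κ →
        Set.ncard {Q : {Q : P2 // Q ∈ A.sing} | κ Q = true} = 2 ∧
        Set.ncard {Q : {Q : P2 // Q ∈ A.sing} | κ Q = false} = 2)) ∧
    (∀ i j k : Fin 4, i ≠ j → i ≠ k → j ≠ k →
      ∀ (Dij Dik Djk : P2 →₀ ℕ) (Lij Lik Ljk : BundleData A.plane),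
      IsTangencyDivisor Pt i j Dij → IsTangencyDivisor Pt i k Dik →
      IsTangencyDivisor Pt j k Djk →
      Lij.Valid → Lik.Valid → Ljk.Valid →
      RepOdMinus A.plane (A.f 0 * A.f 1) 1 Lij Dij →
      RepOdMinus A.plane (A.f 0 * A.f 1) 1 Lik Dik →
      RepOdMinus A.plane (A.f 0 * A.f 1) 1 Ljk Djk →
      ¬ BIso Lij Lik ∧ ¬ BIso Lij Ljk ∧ ¬ BIso Lik Ljk) := by
  have h : IsBitangentConfig A l Pt := ⟨hdeg, hlhom, hlne, hldist, htan⟩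
  refine ⟨?_, ?_⟩
  · rintro i j hij D L hD hL ⟨s, hs, hsD⟩
    exact ⟨h.not_bIso_trivBundle hij hL hs hD hsD, h.isOrderTwo hij hL hs hD hsD,
      fun κ hκ => h.ncard_of_isSheafGluingDataOf hij hL hs hD hsD hκ⟩
  · rintro i j k hij hik hjk Dij Dik Djk Lij Lik Ljk hDij hDik hDjk hLij hLik hLjk
      ⟨sij, hsij, hsDij⟩ ⟨sik, hsik, hsDik⟩ ⟨sjk, hsjk, hsDjk⟩
    exact ⟨h.not_bIso hij hik hjk hLij hsij hDij hsDij hLik hsik hDik hsDik,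
      h.not_bIso hij.symm hjk hik hLij hsij hDij.symm hsDij hLjk hsjk hDjk hsDjk,
      h.not_bIso hik.symm hjk.symm hij hLik hsik hDik.symm hsDik hLjk hsjk hDjk.symm hsDjk⟩

end Statement12

end
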